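/- arXiv:1511.02982 — 2 statements merged into one kernel-verified Lean document; each statement's English description precedes it below -/
import Mathlib

section
/- Let X ⊆ cl(𝔹_d) and let λ ∈ Z(I(X)) ∩ 𝔹_d be a point that is not isolated in Z(I(X)) ∩ 𝔹_d. Then there exists a positive representing measure for λ supported on the closed set Z(I(X)) ∩ 𝕊_d. -/
open MeasureTheory Metric Set Filter Topology

noncomputable section

abbrev CB (d : ℕ) : Set (EuclideanSpace ℂ (Fin d)) := Metric.closedBall 0 1

instance (d : ℕ) : CompactSpace (CB d) :=
  isCompact_iff_compactSpace.mp (isCompact_closedBall _ _)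

instance (d : ℕ) : MeasurableSpace (EuclideanSpace ℂ (Fin d)) := borel _

instance (d : ℕ) : BorelSpace (EuclideanSpace ℂ (Fin d)) := ⟨rfl⟩

def polyAlg (d : ℕ) : Subalgebra ℂ C(CB d, ℂ) :=
  Algebra.adjoin ℂ
    { f : C(CB d, ℂ) | ∃ i : Fin d,
        f = ⟨fun z => (z : EuclideanSpace ℂ (Fin d)) i,
             (EuclideanSpace.proj (𝕜 := ℂ) i).continuous.comp continuous_subtype_val⟩ }

def ballAlgSub (d : ℕ) : Subalgebra ℂ C(CB d, ℂ) := (polyAlg d).topologicalClosure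

def ballAlg (d : ℕ) : Set C(CB d, ℂ) := ballAlgSub d

def sphereD (d : ℕ) : Set (CB d) := {z | ‖(z : EuclideanSpace ℂ (Fin d))‖ = 1}

def openD (d : ℕ) : Set (CB d) := {z | ‖(z : EuclideanSpace ℂ (Fin d))‖ < 1}

def ZS (d : ℕ) (S : Set C(CB d, ℂ)) : Set (CB d) := {z | ∀ φ ∈ S, φ z = 0}

def IX (d : ℕ) (X : Set (CB d)) : Set C(CB d, ℂ) :=
  {φ | φ ∈ ballAlg d ∧ ∀ z ∈ X, φ z = 0}

def IsZeroSet (d : ℕ) (X : Set (CB d)) : Prop :=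
  ∃ S ⊆ ballAlg d, X = ZS d S

/-- A representing measure for a point of the closed ball: a finite positive regular
Borel measure integrating every function of the ball algebra to its value at the point. -/
def IsRepMeasure (d : ℕ) (lam : CB d) (μ : Measure (CB d)) : Prop :=
  IsFiniteMeasure μ ∧ μ.Regular ∧ ∀ φ ∈ ballAlg d, φ lam = ∫ z, φ z ∂μ

/-- `X̂₀` : `X₀` together with all points of the open ball having a representing measure
supported on `X₀`. -/
def hatSet (d : ℕ) (X0 : Set (CB d)) : Set (CB d) :=
  X0 ∪ {lam | lam ∈ openD d ∧
    ∃ μ : Measure (CB d), IsRepMeasure d lam μ ∧ μ X0ᶜ = 0}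

/-- `z` is an isolated point of the set `A`. -/
def IsIsolatedIn (d : ℕ) (A : Set (CB d)) (z : CB d) : Prop :=
  z ∈ A ∧ ∃ U : Set (CB d), IsOpen U ∧ U ∩ A = {z}

/-- A closed ideal of the ball algebra. -/
structure IsClosedIdeal (d : ℕ) (J : Set C(CB d, ℂ)) : Prop where
  subset : J ⊆ ballAlg d
  closed : IsClosed J
  zero_mem : (0 : C(CB d, ℂ)) ∈ J
  add_mem : ∀ f ∈ J, ∀ g ∈ J, f + g ∈ J
  smul_mem : ∀ (c : ℂ), ∀ f ∈ J, c • f ∈ J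
  mul_mem : ∀ f ∈ ballAlg d, ∀ g ∈ J, f * g ∈ J

/-- An `A(𝔹_d)`-Henkin (finite positive regular Borel) measure on the sphere. -/
def IsHenkin (d : ℕ) (μ : Measure (CB d)) : Prop :=
  IsFiniteMeasure μ ∧ μ.Regular ∧ μ (sphereD d)ᶜ = 0 ∧
    ∀ f : ℕ → C(CB d, ℂ), (∀ n, f n ∈ ballAlg d) → (∃ C : ℝ, ∀ n, ‖f n‖ ≤ C) →
      (∀ z ∈ openD d, Tendsto (fun n => f n z) atTop (𝓝 0)) →
      Tendsto (fun n => ∫ z, f n z ∂μ) atTop (𝓝 0)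

/-- An `A(𝔹_d)`-totally null subset of the sphere. -/
def IsTotallyNull (d : ℕ) (K : Set (CB d)) : Prop :=
  K ⊆ sphereD d ∧ ∀ μ : Measure (CB d), IsHenkin d μ → μ K = 0

/-- A complex regular Borel measure on the sphere, given by its polar decomposition:
total variation `var` (a finite positive regular Borel measure concentrated on the
sphere) and a unimodular density. -/
structure CMeasure (d : ℕ) where
  var : Measure (CB d)
  density : CB d → ℂ
  finite : IsFiniteMeasure var
  regular : var.Regular
  measurable_density : Measurable density
  norm_density : ∀ z, ‖density z‖ = 1
  onSphere : var (sphereD d)ᶜ = 0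

/-- Integral of a continuous function against a complex measure. -/
def cInt (d : ℕ) (μ : CMeasure d) (φ : C(CB d, ℂ)) : ℂ :=
  ∫ z, φ z * μ.density z ∂μ.var

/-- An `A(𝔹_d)`-Henkin complex measure on the sphere. -/
def IsHenkinC (d : ℕ) (μ : CMeasure d) : Prop :=
  ∀ f : ℕ → C(CB d, ℂ), (∀ n, f n ∈ ballAlg d) → (∃ C : ℝ, ∀ n, ‖f n‖ ≤ C) →
    (∀ z ∈ openD d, Tendsto (fun n => f n z) atTop (𝓝 0)) →
    Tendsto (fun n => cInt d μ (f n)) atTop (𝓝 0)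

/-- An `A(𝔹_d)`-totally singular complex measure: its total variation is mutually
singular with that of every Henkin complex measure. -/
def IsTotallySingularC (d : ℕ) (μ : CMeasure d) : Prop :=
  ∀ ν : CMeasure d, IsHenkinC d ν → μ.var ⟂ₘ ν.var

/-- An `A(𝔹_d)`-totally null Borel subset of the sphere (complex-measure version). -/
def IsTotallyNullC (d : ℕ) (K : Set (CB d)) : Prop :=
  K ⊆ sphereD d ∧ ∀ μ : CMeasure d, IsHenkinC d μ → μ.var K = 0


theorem le_of_forall_pow_le_mul_pow {a b C : ℝ} (hb : 0 ≤ b)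
    (h : ∀ k : ℕ, 0 < k → a ^ k ≤ C * b ^ k) : a ≤ b := by
  by_contra! hab
  have ha' : 0 < a := hb.trans_lt hab
  have ht : Tendsto (fun k : ℕ => C * (b / a) ^ k) atTop (𝓝 (C * 0)) :=
    (tendsto_pow_atTop_nhds_zero_of_lt_one (by positivity) ((div_lt_one ha').2 hab)).const_mul C
  have h1 : ∀ᶠ k : ℕ in atTop, 1 ≤ C * (b / a) ^ k := by
    filter_upwards [eventually_gt_atTop 0] with k hk
    rw [div_pow, ← mul_div_assoc, le_div_iff₀ (by positivity), one_mul]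
    exact h k hk
  have := ge_of_tendsto ht h1
  norm_num at this

theorem exists_norm_pow_le_of_forall_character {D : Type*} [NormedCommRing D] [NormedAlgebra ℂ D]
    [CompleteSpace D] {a : D} {c c' : ℝ} (hc : 0 ≤ c) (hcc' : c < c')
    (h : ∀ χ : WeakDual.characterSpace ℂ D, ‖χ a‖ ≤ c) : ∃ K, ∀ k : ℕ, ‖a ^ k‖ ≤ K * c' ^ k := by
  have hc' : 0 < c' := hc.trans_lt hcc'
  have hr : spectralRadius ℂ a ≤ ENNReal.ofReal c := by
    refine iSup₂_le fun z hz => ?_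
    obtain ⟨χ, rfl⟩ := WeakDual.CharacterSpace.mem_spectrum_iff_exists.1 hz
    exact (ofReal_norm (χ a)).symm.trans_le (ENNReal.ofReal_le_ofReal (h χ))
  have hlt : spectralRadius ℂ a < ENNReal.ofReal c' :=
    hr.trans_lt ((ENNReal.ofReal_lt_ofReal_iff hc').2 hcc')
  have hev := (spectrum.pow_norm_pow_one_div_tendsto_nhds_spectralRadius a).eventually_lt_const hlt
  have hbd : IsBoundedUnder (· ≤ ·) atTop fun k : ℕ => ‖a ^ k‖ / c' ^ k := by
    refine ⟨1, ?_⟩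
    rw [eventually_map]
    filter_upwards [hev, eventually_gt_atTop 0] with k hk hk0
    rw [ENNReal.ofReal_lt_ofReal_iff hc'] at hk
    have h2 := pow_le_pow_left₀ (by positivity) hk.le k
    rw [one_div, Real.rpow_inv_natCast_pow (norm_nonneg _) hk0.ne'] at h2
    exact (div_le_one (by positivity)).2 h2
  obtain ⟨K, hK⟩ := hbd.bddAbove_range
  exact ⟨K, fun k => (div_le_iff₀ (by positivity)).1 (hK (mem_range_self k))⟩

/-- The Gelfand spectral radius bound for a submultiplicative seminorm on a commutative algebra. -/
theorem exists_seminorm_pow_le_of_forall_character {A : Type*} [CommRing A] [Algebra ℂ A]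
    (γ : A → ℝ) (h0 : γ 0 = 0) (hnonneg : ∀ f, 0 ≤ γ f) (hadd : ∀ f g, γ (f + g) ≤ γ f + γ g)
    (hmul : ∀ f g, γ (f * g) ≤ γ f * γ g) (hsmul : ∀ (z : ℂ) (f), γ (z • f) ≤ ‖z‖ * γ f)
    {a : A} {c c' : ℝ} (hc : 0 ≤ c) (hcc' : c < c')
    (h : ∀ χ : A →ₐ[ℂ] ℂ, (∀ f, ‖χ f‖ ≤ γ f) → ‖χ a‖ ≤ c) :
    ∃ K, ∀ k : ℕ, γ (a ^ k) ≤ K * c' ^ k := by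
  have hneg : ∀ f, γ (-f) = γ f := by
    have : ∀ f, γ (-f) ≤ γ f := fun f => by simpa using hsmul (-1) f
    exact fun f => (this f).antisymm (by simpa using this (-f))
  let R : RingSeminorm A :=
    { toFun := γ
      map_zero' := h0
      add_le' := hadd
      neg' := hneg
      mul_le' := hmul }
  let : SeminormedRing A := R.toSeminormedRing
  let : SeminormedCommRing A := { R.toSeminormedRing, (inferInstance : CommRing A) with }
  let : NormedAlgebra ℂ A := { (inferInstance : Algebra ℂ A) with norm_smul_le := hsmul }
  have hn : ∀ f : A, ‖f‖ = γ f := fun f => rfl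
  obtain ⟨K, hK⟩ := exists_norm_pow_le_of_forall_character
      (a := ((a : A) : UniformSpace.Completion A)) hc hcc' fun φ => by
    let χ : A →ₐ[ℂ] ℂ :=
      (WeakDual.CharacterSpace.toAlgHom φ).comp
        { UniformSpace.Completion.coeRingHom (α := A) with commutes' := fun r => rfl }
    refine h χ fun f => le_of_forall_pow_le_mul_pow (C := ‖(1 : UniformSpace.Completion A)‖)
      (hnonneg f) fun k hk => ?_
    have h1 : ‖χ (f ^ k)‖ ≤ _ :=
      AlgHom.norm_apply_le_self_mul_norm_one (WeakDual.CharacterSpace.toAlgHom φ)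
        ((f ^ k : A) : UniformSpace.Completion A)
    rw [map_pow, norm_pow, UniformSpace.Completion.norm_coe, hn, mul_comm] at h1
    refine h1.trans (mul_le_mul_of_nonneg_left ?_ (norm_nonneg _))
    exact norm_pow_le' f hk
  refine ⟨K, fun k => ?_⟩
  have hcoe : ((a ^ k : A) : UniformSpace.Completion A) = (a : UniformSpace.Completion A) ^ k :=
    map_pow (UniformSpace.Completion.coeRingHom (α := A)) a k
  have := hK k
  rwa [← hcoe, UniformSpace.Completion.norm_coe] at this

section EssentialSeminorm

variable {A : Type*} [NormedCommRing A] [NormedAlgebra ℂ A]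

/-- The action `(f • ℓ)(g) = ℓ (f * g)` of an algebra on its dual. -/
def dualAct (f : A) (ℓ : A →L[ℂ] ℂ) : A →L[ℂ] ℂ := ℓ.comp (ContinuousLinearMap.mul ℂ A f)

@[simp] theorem dualAct_apply (f g : A) (ℓ : A →L[ℂ] ℂ) : dualAct f ℓ g = ℓ (f * g) := rfl

theorem dualAct_sub (f : A) (ℓ ℓ' : A →L[ℂ] ℂ) :
    dualAct f (ℓ - ℓ') = dualAct f ℓ - dualAct f ℓ' := by ext; simp

/-- The functionals of norm at most one that annihilate the ideal `J`. -/
def annBall (J : Ideal A) : Set (A →L[ℂ] ℂ) := {ℓ | ‖ℓ‖ ≤ 1 ∧ ∀ f ∈ J, ℓ f = 0}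

theorem zero_mem_annBall (J : Ideal A) : 0 ∈ annBall J := by simp [annBall]

/-- The set `f • annBall J` is covered by finitely many sets of diameter at most `ε`. -/
def FiniteCover (J : Ideal A) (f : A) (ε : ℝ) : Prop :=
  ∃ (ι : Type) (_ : Finite ι) (c : (A →L[ℂ] ℂ) → ι),
    ∀ ℓ ∈ annBall J, ∀ ℓ' ∈ annBall J, c ℓ = c ℓ' → ‖dualAct f (ℓ - ℓ')‖ ≤ ε

/-- The Kuratowski measure of noncompactness of multiplication by `f` on the dual of `A ⧸ J`. -/
def essNorm (J : Ideal A) (f : A) : ℝ := sInf {ε | 0 ≤ ε ∧ FiniteCover J f ε}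

variable {J : Ideal A}

theorem FiniteCover.nonneg {f : A} {ε : ℝ} (h : FiniteCover J f ε) : 0 ≤ ε := by
  obtain ⟨ι, _, c, hc⟩ := h
  exact (norm_nonneg _).trans (hc 0 (zero_mem_annBall J) 0 (zero_mem_annBall J) rfl)

theorem essNorm_nonneg (J : Ideal A) (f : A) : 0 ≤ essNorm J f :=
  Real.sInf_nonneg fun _ h => h.1

theorem essNorm_le {f : A} {ε : ℝ} (h : FiniteCover J f ε) : essNorm J f ≤ ε :=
  csInf_le ⟨0, fun _ h => h.1⟩ ⟨h.nonneg, h⟩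

theorem finiteCover_norm (J : Ideal A) (f : A) : FiniteCover J f (2 * ‖f‖) := by
  refine ⟨Unit, inferInstance, fun _ => (), fun ℓ hℓ ℓ' hℓ' _ => ?_⟩
  refine ContinuousLinearMap.opNorm_le_bound _ (by positivity) fun g => ?_
  have h1 : ‖ℓ - ℓ'‖ ≤ 2 := (norm_sub_le _ _).trans (by linarith [hℓ.1, hℓ'.1])
  calc ‖dualAct f (ℓ - ℓ') g‖ ≤ ‖ℓ - ℓ'‖ * ‖f * g‖ := (ℓ - ℓ').le_opNorm _
    _ ≤ 2 * (‖f‖ * ‖g‖) := by gcongr; exact norm_mul_le _ _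
    _ = 2 * ‖f‖ * ‖g‖ := by ring

theorem finiteCover_of_essNorm_lt {f : A} {ε : ℝ} (h : essNorm J f < ε) : FiniteCover J f ε := by
  obtain ⟨δ, ⟨_, ι, hι, c, hc⟩, hδ⟩ :=
    exists_lt_of_csInf_lt (s := {ε | 0 ≤ ε ∧ FiniteCover J f ε})
      ⟨_, by positivity, finiteCover_norm J f⟩ h
  exact ⟨ι, hι, c, fun ℓ hℓ ℓ' hℓ' e => (hc ℓ hℓ ℓ' hℓ' e).trans hδ.le⟩

theorem essNorm_eq_zero_of_mem {f : A} (hf : f ∈ J) : essNorm J f = 0 := by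
  refine (essNorm_le ⟨Unit, inferInstance, fun _ => (), fun ℓ hℓ ℓ' hℓ' _ => ?_⟩).antisymm
    (essNorm_nonneg J f)
  refine ContinuousLinearMap.opNorm_le_bound _ le_rfl fun g => ?_
  have := J.mul_mem_right g hf
  simp [hℓ.2 _ this, hℓ'.2 _ this]

theorem essNorm_zero (J : Ideal A) : essNorm J 0 = 0 := essNorm_eq_zero_of_mem J.zero_mem

theorem essNorm_add_le (J : Ideal A) (f g : A) :
    essNorm J (f + g) ≤ essNorm J f + essNorm J g := by
  refine le_of_forall_pos_le_add fun δ hδ => ?_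
  obtain ⟨ι, _, c, hc⟩ := finiteCover_of_essNorm_lt (lt_add_of_pos_right (essNorm J f) (half_pos hδ))
  obtain ⟨κ, _, b, hb⟩ := finiteCover_of_essNorm_lt (lt_add_of_pos_right (essNorm J g) (half_pos hδ))
  refine essNorm_le ⟨ι × κ, inferInstance, fun ℓ => (c ℓ, b ℓ), fun ℓ hℓ ℓ' hℓ' e => ?_⟩
  have h1 := hc ℓ hℓ ℓ' hℓ' (congrArg Prod.fst e)
  have h2 := hb ℓ hℓ ℓ' hℓ' (congrArg Prod.snd e)
  have h3 : dualAct (f + g) (ℓ - ℓ') = dualAct f (ℓ - ℓ') + dualAct g (ℓ - ℓ') := by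
    ext x; simp only [dualAct_apply, add_mul, map_add, add_apply]
  rw [h3]
  exact (norm_add_le _ _).trans (by linarith)

theorem essNorm_smul_le (J : Ideal A) (z : ℂ) (f : A) :
    essNorm J (z • f) ≤ ‖z‖ * essNorm J f := by
  refine le_of_forall_pos_le_add fun δ hδ => ?_
  have hz : 0 < ‖z‖ + 1 := by positivity
  obtain ⟨ι, _, c, hc⟩ :=
    finiteCover_of_essNorm_lt (lt_add_of_pos_right (essNorm J f) (div_pos hδ hz))
  refine essNorm_le ⟨ι, inferInstance, c, fun ℓ hℓ ℓ' hℓ' e => ?_⟩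
  have h3 : dualAct (z • f) (ℓ - ℓ') = z • dualAct f (ℓ - ℓ') := by
    ext x; simp only [dualAct_apply, smul_mul_assoc, map_smul, smul_apply]
  rw [h3, norm_smul]
  calc ‖z‖ * ‖dualAct f (ℓ - ℓ')‖ ≤ ‖z‖ * (essNorm J f + δ / (‖z‖ + 1)) := by
        gcongr; exact hc ℓ hℓ ℓ' hℓ' e
    _ = ‖z‖ * essNorm J f + δ * (‖z‖ / (‖z‖ + 1)) := by ring
    _ ≤ ‖z‖ * essNorm J f + δ * 1 := by
        gcongr; exact (div_le_one hz).2 (by linarith)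
    _ = _ := by ring

theorem FiniteCover.mul {f g : A} {ε δ : ℝ} (hε : 0 < ε) (hf : FiniteCover J f ε)
    (hg : FiniteCover J g δ) : FiniteCover J (f * g) (ε * δ) := by
  classical
  obtain ⟨ι, _, c, hc⟩ := hf
  obtain ⟨κ, _, b, hb⟩ := hg
  let r : ι → (A →L[ℂ] ℂ) := fun i =>
    if h : ∃ ℓ ∈ annBall J, c ℓ = i then h.choose else 0
  have hr : ∀ ℓ ∈ annBall J, r (c ℓ) ∈ annBall J ∧ c (r (c ℓ)) = c ℓ := fun ℓ hℓ => by
    have h : ∃ ℓ' ∈ annBall J, c ℓ' = c ℓ := ⟨ℓ, hℓ, rfl⟩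
    simp only [r, dif_pos h]
    exact h.choose_spec
  let s : (A →L[ℂ] ℂ) → (A →L[ℂ] ℂ) := fun ℓ => (ε⁻¹ : ℂ) • dualAct f (ℓ - r (c ℓ))
  have hs : ∀ ℓ ∈ annBall J, s ℓ ∈ annBall J := fun ℓ hℓ => by
    obtain ⟨h1, h2⟩ := hr ℓ hℓ
    refine ⟨?_, fun x hx => ?_⟩
    · have := hc ℓ hℓ _ h1 h2.symm
      rw [norm_smul, norm_inv, Complex.norm_real, Real.norm_of_nonneg hε.le,
        inv_mul_le_iff₀ hε, mul_one]
      exact this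
    · have := J.mul_mem_left f hx
      simp [s, hℓ.2 _ this, h1.2 _ this]
  refine ⟨ι × κ, inferInstance, fun ℓ => (c ℓ, b (s ℓ)), fun ℓ hℓ ℓ' hℓ' e => ?_⟩
  have e1 : c ℓ = c ℓ' := congrArg Prod.fst e
  have h2 := hb _ (hs ℓ hℓ) _ (hs ℓ' hℓ') (congrArg Prod.snd e)
  have h3 : dualAct (f * g) (ℓ - ℓ') = (ε : ℂ) • dualAct g (s ℓ - s ℓ') := by
    have hε' : (ε : ℂ) ≠ 0 := by exact_mod_cast hε.ne'
    ext x
    simp only [s, e1, dualAct_apply, smul_apply,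
      sub_apply, smul_eq_mul, mul_assoc]
    field_simp
    ring
  rw [h3, norm_smul, Complex.norm_real, Real.norm_of_nonneg hε.le]
  gcongr

theorem essNorm_mul_le (J : Ideal A) (f g : A) :
    essNorm J (f * g) ≤ essNorm J f * essNorm J g := by
  have h : ∀ᶠ δ in 𝓝[>] (0 : ℝ), essNorm J (f * g) ≤ (essNorm J f + δ) * (essNorm J g + δ) := by
    filter_upwards [self_mem_nhdsWithin] with δ hδ
    exact essNorm_le (.mul (add_pos_of_nonneg_of_pos (essNorm_nonneg J f) hδ)
      (finiteCover_of_essNorm_lt (lt_add_of_pos_right _ hδ))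
      (finiteCover_of_essNorm_lt (lt_add_of_pos_right _ hδ)))
  have hc : Tendsto (fun δ : ℝ => (essNorm J f + δ) * (essNorm J g + δ)) (𝓝[>] 0)
      (𝓝 ((essNorm J f + 0) * (essNorm J g + 0))) :=
    (Continuous.tendsto (by fun_prop) 0).mono_left nhdsWithin_le_nhds
  simpa using ge_of_tendsto hc h

/-- If every functional is controlled by its value at `1` and its products with `w i`, then
`essNorm` is controlled by the products with `w i`. -/
theorem essNorm_le_mul_sum {ι : Type} [Fintype ι] (J : Ideal A) (w : ι → A) {C₀ C : ℝ}
    (hC₀ : 0 ≤ C₀) (hC : 0 ≤ C)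
    (h : ∀ ℓ : A →L[ℂ] ℂ, ‖ℓ‖ ≤ C₀ * ‖ℓ 1‖ + C * ∑ i, ‖dualAct (w i) ℓ‖) (u : A) :
    essNorm J u ≤ C * ∑ i, essNorm J (u * w i) := by
  classical
  have key : ∀ η > 0, essNorm J u ≤ C₀ * η + C * ∑ i, (essNorm J (u * w i) + η) := by
    intro η hη
    choose κ hκ c hc using fun i =>
      finiteCover_of_essNorm_lt (lt_add_of_pos_right (essNorm J (u * w i)) hη)
    obtain ⟨t, ht, htc⟩ := Metric.totallyBounded_iff.1
      (isCompact_closedBall (0 : ℂ) ‖u‖).totallyBounded (η / 2) (half_pos hη)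
    have hmem : ∀ ℓ ∈ annBall J, ∃ y : t, dist (ℓ u) y < η / 2 := fun ℓ hℓ => by
      have : ℓ u ∈ closedBall (0 : ℂ) ‖u‖ := by
        rw [mem_closedBall_zero_iff]
        exact (ℓ.le_opNorm u).trans (mul_le_of_le_one_left (norm_nonneg _) hℓ.1)
      simpa using htc this
    obtain ⟨y₀, -⟩ := hmem 0 (zero_mem_annBall J)
    have := ht.to_subtype
    let a : (A →L[ℂ] ℂ) → t := fun ℓ =>
      if h : ∃ y : t, dist (ℓ u) y < η / 2 then h.choose else y₀
    have ha : ∀ ℓ ∈ annBall J, dist (ℓ u) (a ℓ) < η / 2 := fun ℓ hℓ => by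
      simp only [a, dif_pos (hmem ℓ hℓ)]
      exact (hmem ℓ hℓ).choose_spec
    refine essNorm_le ⟨t × ((i : ι) → κ i), inferInstance, fun ℓ => (a ℓ, fun i => c i ℓ),
      fun ℓ hℓ ℓ' hℓ' e => ?_⟩
    have e1 : a ℓ = a ℓ' := congrArg Prod.fst e
    refine (h _).trans (add_le_add ?_ ?_)
    · refine mul_le_mul_of_nonneg_left ?_ hC₀
      have h1 := ha ℓ hℓ
      have h2 := ha ℓ' hℓ'
      rw [← e1] at h2
      simp only [dualAct_apply, mul_one, sub_apply, ← dist_eq_norm]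
      linarith [dist_triangle_right (ℓ u) (ℓ' u) (a ℓ)]
    · refine mul_le_mul_of_nonneg_left (Finset.sum_le_sum fun i _ => ?_) hC
      have h1 := hc i ℓ hℓ ℓ' hℓ' (congrFun (congrArg Prod.snd e) i)
      have e2 : dualAct (w i) (dualAct u (ℓ - ℓ')) = dualAct (u * w i) (ℓ - ℓ') :=
        ContinuousLinearMap.ext fun x => by simp only [dualAct_apply, mul_assoc]
      rwa [e2]
  have hc : Tendsto (fun η : ℝ => C₀ * η + C * ∑ i, (essNorm J (u * w i) + η)) (𝓝[>] 0)
      (𝓝 (C₀ * 0 + C * ∑ i, (essNorm J (u * w i) + 0))) :=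
    (Continuous.tendsto (by fun_prop) 0).mono_left nhdsWithin_le_nhds
  simpa using ge_of_tendsto hc (by filter_upwards [self_mem_nhdsWithin] with η hη using key η hη)

end EssentialSeminorm

section Characters

variable {A : Type*} [NormedCommRing A] [NormedAlgebra ℂ A]

/-- The functionals that annihilate every common zero of the first `n` characters. -/
def charSpan (χ : ℕ → WeakDual.characterSpace ℂ A) (n : ℕ) : Submodule ℂ (A →L[ℂ] ℂ) where
  carrier := {ℓ | ∀ g, (∀ j < n, χ j g = 0) → ℓ g = 0}
  zero_mem' := fun _ _ => rfl
  add_mem' := fun {a b} ha hb g hg => by rw [add_apply, ha g hg, hb g hg, add_zero]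
  smul_mem' := fun c a ha g hg => by rw [smul_apply, ha g hg, smul_zero]

variable {χ : ℕ → WeakDual.characterSpace ℂ A}

theorem isClosed_charSpan (n : ℕ) : IsClosed (charSpan χ n : Set (A →L[ℂ] ℂ)) := by
  have : (charSpan χ n : Set (A →L[ℂ] ℂ)) =
      ⋂ (g : A) (_ : ∀ j < n, χ j g = 0), {ℓ | ℓ g = 0} := by
    ext ℓ; simp [charSpan]
  rw [this]
  exact isClosed_iInter fun g => isClosed_iInter fun _ =>
    isClosed_eq (by fun_prop) continuous_const

theorem charSpan_mono {m n : ℕ} (h : m ≤ n) : charSpan χ m ≤ charSpan χ n :=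
  fun _ hℓ g hg => hℓ g fun j hj => hg j (hj.trans_le h)

theorem dualAct_mem_charSpan (f : A) {n : ℕ} {ℓ : A →L[ℂ] ℂ} (h : ℓ ∈ charSpan χ n) :
    dualAct f ℓ ∈ charSpan χ n :=
  fun g hg => h (f * g) fun j hj => by rw [map_mul, hg j hj, mul_zero]

theorem toCLM_mem_charSpan (n : ℕ) :
    WeakDual.CharacterSpace.toCLM (χ n) ∈ charSpan χ (n + 1) :=
  fun _ hg => hg n n.lt_succ_self

theorem toCLM_notMem_charSpan (hχ : Function.Injective χ) (n : ℕ) :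
    WeakDual.CharacterSpace.toCLM (χ n) ∉ charSpan χ n := by
  intro h
  have hsep : ∀ j, ∃ g : A, j < n → χ j g ≠ χ n g := fun j => by
    by_cases hj : j < n
    · have : χ j ≠ χ n := hχ.ne hj.ne
      obtain ⟨g, hg⟩ := DFunLike.ne_iff.1 this
      exact ⟨g, fun _ => hg⟩
    · exact ⟨0, fun h => absurd h hj⟩
  choose g hg using hsep
  have h0 := h (∏ j ∈ Finset.range n, (g j - algebraMap ℂ A (χ j (g j)))) fun j hj => by
    rw [map_prod]
    refine Finset.prod_eq_zero (Finset.mem_range.2 hj) ?_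
    simp [AlgHomClass.commutes]
  change χ n _ = 0 at h0
  rw [map_prod, Finset.prod_eq_zero_iff] at h0
  obtain ⟨j, hj, h1⟩ := h0
  rw [map_sub, AlgHomClass.commutes, sub_eq_zero] at h1
  exact hg j (Finset.mem_range.1 hj) h1.symm

/-- An infinite family of characters that annihilate `J` and are bounded below on `f` forces
multiplication by `f` on the dual of `A ⧸ J` to be noncompact. -/
theorem le_essNorm_of_injective {J : Ideal A} (hχ : Function.Injective χ)
    (hJ : ∀ n, ∀ g ∈ J, χ n g = 0) {f : A} {c : ℝ} (hc : ∀ n, c ≤ ‖χ n f‖) :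
    c ≤ 2 * essNorm J f := by
  have hy : ∀ n, ∃ y ∈ annBall J, y ∈ charSpan χ (n + 1) ∧
      ∀ x ∈ charSpan χ n, ‖χ n f‖ ≤ 2 * ‖dualAct f y - x‖ := by
    intro n
    set δ := WeakDual.CharacterSpace.toCLM (χ n) with hδ
    have hne : (charSpan χ n : Set (A →L[ℂ] ℂ)).Nonempty := ⟨0, zero_mem _⟩
    have hpos : 0 < infDist δ (charSpan χ n) :=
      ((isClosed_charSpan n).notMem_iff_infDist_pos hne).1 (toCLM_notMem_charSpan hχ n)
    obtain ⟨e, he, hde⟩ := (infDist_lt_iff hne).1 (lt_two_mul_self hpos)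
    set r := ‖δ - e‖ with hr
    rw [dist_eq_norm] at hde
    have hrpos : 0 < r := by
      have := infDist_le_dist_of_mem (x := δ) he
      rw [dist_eq_norm] at this
      exact hpos.trans_le this
    have hr0 : (r : ℂ) ≠ 0 := by exact_mod_cast hrpos.ne'
    have heS : e ∈ charSpan χ (n + 1) := charSpan_mono n.le_succ he
    refine ⟨(r : ℂ)⁻¹ • (δ - e), ⟨?_, fun g hg => ?_⟩,
      Submodule.smul_mem _ _ (sub_mem (toCLM_mem_charSpan n) heS), fun x hx => ?_⟩
    · rw [norm_smul, norm_inv, Complex.norm_real, norm_norm, inv_mul_cancel₀ hrpos.ne']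
    · have h1 : δ g = 0 := hJ n g hg
      have h2 : e g = 0 := he g fun j _ => hJ j g hg
      rw [smul_apply, sub_apply, h1, h2, sub_zero, smul_zero]
    · rcases eq_or_ne (χ n f) 0 with h0 | h0
      · rw [h0, norm_zero]; positivity
      have hact : dualAct f δ = χ n f • δ := by
        ext g
        exact map_mul (χ n) f g
      have key : dualAct f ((r : ℂ)⁻¹ • (δ - e)) - x =
          (χ n f * (r : ℂ)⁻¹) • (δ - (χ n f)⁻¹ • (dualAct f e + (r : ℂ) • x)) := by
        have h1 : dualAct f ((r : ℂ)⁻¹ • (δ - e)) = (r : ℂ)⁻¹ • (χ n f • δ - dualAct f e) := by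
          rw [← hact]; ext g; simp
        rw [h1]
        ext g
        simp only [sub_apply, smul_apply, add_apply, smul_eq_mul]
        field_simp
        ring
      have hmem : (χ n f)⁻¹ • (dualAct f e + (r : ℂ) • x) ∈ charSpan χ n :=
        Submodule.smul_mem _ _
          (add_mem (dualAct_mem_charSpan f he) (Submodule.smul_mem _ _ hx))
      have h2 := infDist_le_dist_of_mem (x := δ) hmem
      rw [dist_eq_norm] at h2
      rw [key, norm_smul, norm_mul, norm_inv, Complex.norm_real, Real.norm_of_nonneg hrpos.le]
      have h3 : r ≤ 2 * ‖δ - (χ n f)⁻¹ • (dualAct f e + (r : ℂ) • x)‖ := by linarith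
      calc ‖χ n f‖ = ‖χ n f‖ * r⁻¹ * r := by field_simp
        _ ≤ ‖χ n f‖ * r⁻¹ * (2 * ‖δ - (χ n f)⁻¹ • (dualAct f e + (r : ℂ) • x)‖) := by gcongr
        _ = _ := by ring
  choose y hyJ hyS hyx using hy
  refine le_of_forall_pos_le_add fun η hη => ?_
  obtain ⟨ι, _, a, ha⟩ :=
    finiteCover_of_essNorm_lt (lt_add_of_pos_right (essNorm J f) (half_pos hη))
  have main : ∀ m n, m < n → a (y m) = a (y n) → c ≤ 2 * essNorm J f + η := by
    intro m n hmn e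
    have h1 := ha _ (hyJ n) _ (hyJ m) e.symm
    have h2 := hyx n (dualAct f (y m))
      (dualAct_mem_charSpan f (charSpan_mono hmn (hyS m)))
    rw [← dualAct_sub] at h2
    linarith [hc n]
  obtain ⟨m, n, hmn, e⟩ := Finite.exists_ne_map_eq_of_infinite fun n => a (y n)
  rcases hmn.lt_or_gt with h | h
  · exact main m n h e
  · exact main n m h e.symm

end Characters

section BallAlgebra

variable {d : ℕ}

instance : CompleteSpace (ballAlgSub d) :=
  (Subalgebra.isClosed_topologicalClosure (polyAlg d)).completeSpace_coe

/-- The coordinate functions as elements of the ball algebra. -/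
def coordFn (i : Fin d) : ballAlgSub d :=
  ⟨⟨fun z => (z : EuclideanSpace ℂ (Fin d)) i,
      (EuclideanSpace.proj (𝕜 := ℂ) i).continuous.comp continuous_subtype_val⟩,
    Subalgebra.le_topologicalClosure _ (Algebra.subset_adjoin ⟨i, rfl⟩)⟩

/-- Evaluation at a point of the closed ball. -/
def evalAt (z : CB d) : ballAlgSub d →ₐ[ℂ] ℂ :=
  (ContinuousMap.evalAlgHom ℂ ℂ z).comp (ballAlgSub d).val

@[simp] theorem evalAt_apply (z : CB d) (f : ballAlgSub d) : evalAt z f = (f : C(CB d, ℂ)) z := rfl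

@[simp] theorem evalAt_coordFn (z : CB d) (i : Fin d) : evalAt z (coordFn i) = z.1 i := rfl

theorem norm_evalAt_le (z : CB d) (f : ballAlgSub d) : ‖evalAt z f‖ ≤ ‖f‖ :=
  (f : C(CB d, ℂ)).norm_coe_le_norm z

theorem continuous_evalAt (z : CB d) : Continuous (evalAt z) :=
  (continuous_eval_const z).comp continuous_subtype_val

/-- The polynomial functions in the ball algebra. -/
def polyFn : MvPolynomial (Fin d) ℂ →ₐ[ℂ] ballAlgSub d := MvPolynomial.aeval coordFn

theorem evalAt_polyFn (z : CB d) (P : MvPolynomial (Fin d) ℂ) :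
    evalAt z (polyFn P) = MvPolynomial.eval (fun i => z.1 i) P := by
  have h : (evalAt z).comp polyFn = MvPolynomial.aeval fun i => z.1 i := by
    ext i
    simp only [polyFn, AlgHom.comp_apply, MvPolynomial.aeval_X, evalAt_coordFn]
  rw [← AlgHom.comp_apply, h, MvPolynomial.aeval_eq_eval]

theorem denseRange_polyFn : DenseRange (polyFn (d := d)) := by
  have hr : ∀ g ∈ polyAlg d, ∃ P, ((polyFn P : ballAlgSub d) : C(CB d, ℂ)) = g := by
    intro g hg
    have h1 : polyAlg d = ((ballAlgSub d).val.comp polyFn).range := by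
      have h2 : (ballAlgSub d).val.comp polyFn =
          MvPolynomial.aeval fun i => ((coordFn i : ballAlgSub d) : C(CB d, ℂ)) := by
        ext1 i; simp [polyFn]
      rw [h2, ← Algebra.adjoin_range_eq_range_aeval, polyAlg]
      congr 1
      ext f
      exact ⟨fun ⟨i, hi⟩ => ⟨i, hi.symm⟩, fun ⟨i, hi⟩ => ⟨i, hi.symm⟩⟩
    rw [h1] at hg
    exact hg
  intro f
  refine Metric.mem_closure_iff.2 fun ε hε => ?_
  obtain ⟨g, hg, hfg⟩ := Metric.mem_closure_iff.1 f.2 ε hε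
  obtain ⟨P, rfl⟩ := hr g hg
  exact ⟨_, mem_range_self P, hfg⟩

/-- Every bounded character of the ball algebra is a point evaluation. -/
theorem exists_eq_evalAt {χ : ballAlgSub d →ₐ[ℂ] ℂ} {C : ℝ} (h : ∀ f, ‖χ f‖ ≤ C * ‖f‖) :
    ∃ z : CB d, χ = evalAt z := by
  have h1 : ∀ f, ‖χ f‖ ≤ ‖f‖ := fun f =>
    le_of_forall_pow_le_mul_pow (C := |C|) (norm_nonneg f) fun k hk => by
      rw [← norm_pow, ← map_pow]
      refine (h _).trans ?_
      exact mul_le_mul (le_abs_self C) (norm_pow_le' f hk) (norm_nonneg _) (abs_nonneg _)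
  let p : EuclideanSpace ℂ (Fin d) := WithLp.toLp 2 fun i => χ (coordFn i)
  have hp : ‖p‖ ≤ 1 := by
    set g : ballAlgSub d := ∑ i, starRingEnd ℂ (p i) • coordFn i with hg
    have hg1 : ‖g‖ ≤ ‖p‖ := by
      refine (ContinuousMap.norm_le _ (norm_nonneg _)).2 fun z => ?_
      have h2 : (g : C(CB d, ℂ)) z = inner ℂ p z.1 := by
        change evalAt z g = _
        rw [hg, map_sum, PiLp.inner_apply]
        refine Finset.sum_congr rfl fun i _ => ?_
        rw [map_smul, evalAt_coordFn, smul_eq_mul, RCLike.inner_apply, mul_comm]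
      change ‖(g : C(CB d, ℂ)) z‖ ≤ _
      rw [h2]
      refine (norm_inner_le_norm _ _).trans (mul_le_of_le_one_right (norm_nonneg _) ?_)
      exact mem_closedBall_zero_iff.1 z.2
    have hg2 : χ g = inner ℂ p p := by
      rw [hg, map_sum, PiLp.inner_apply]
      refine Finset.sum_congr rfl fun i _ => ?_
      rw [map_smul, smul_eq_mul, RCLike.inner_apply, mul_comm]
    have h3 := (h1 g).trans hg1
    rw [hg2, inner_self_eq_norm_sq_to_K, norm_pow, RCLike.norm_ofReal, abs_norm] at h3
    nlinarith [norm_nonneg p]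
  refine ⟨⟨p, mem_closedBall_zero_iff.2 hp⟩, ?_⟩
  have hc : Continuous χ := AddMonoidHomClass.continuous_of_bound χ C h
  ext f
  refine congrFun (denseRange_polyFn.equalizer hc (continuous_evalAt _) ?_) f
  have : χ.comp polyFn = (evalAt ⟨p, mem_closedBall_zero_iff.2 hp⟩).comp polyFn := by
    ext i
    simp only [polyFn, AlgHom.comp_apply, MvPolynomial.aeval_X, evalAt_coordFn]
    rfl
  exact congrArg DFunLike.coe this

end BallAlgebra

section Gleason

variable {d : ℕ}

theorem eq_of_evalAt_eq {f g : ballAlgSub d} (h : ∀ z, evalAt z f = evalAt z g) : f = g :=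
  Subtype.ext (ContinuousMap.ext h)

theorem norm_le_of_norm_evalAt_le {f : ballAlgSub d} {C : ℝ} (hC : 0 ≤ C)
    (h : ∀ z, ‖evalAt z f‖ ≤ C) : ‖f‖ ≤ C :=
  (ContinuousMap.norm_le _ hC).2 h

/-- The value of a polynomial at a point of `ℂ^d`. -/
def polyEval (P : MvPolynomial (Fin d) ℂ) (z : EuclideanSpace ℂ (Fin d)) : ℂ :=
  MvPolynomial.eval (fun i => z i) P

/-- The derivative of a polynomial at `q` in the direction `v`. -/
def polyDeriv (P : MvPolynomial (Fin d) ℂ) (q v : EuclideanSpace ℂ (Fin d)) : ℂ :=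
  ∑ i, v i * polyEval (MvPolynomial.pderiv i P) q

theorem polyDeriv_smul_add (P : MvPolynomial (Fin d) ℂ) (q v w : EuclideanSpace ℂ (Fin d))
    (c : ℂ) : polyDeriv P q (c • v + w) = c * polyDeriv P q v + polyDeriv P q w := by
  simp only [polyDeriv, PiLp.add_apply, PiLp.smul_apply, smul_eq_mul, add_mul,
    Finset.sum_add_distrib, Finset.mul_sum, mul_assoc]

theorem polyDeriv_single (P : MvPolynomial (Fin d) ℂ) (q : EuclideanSpace ℂ (Fin d))
    (i : Fin d) : polyDeriv P q (EuclideanSpace.single i 1) =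
      polyEval (MvPolynomial.pderiv i P) q := by
  simp [polyDeriv]

theorem continuous_polyEval (P : MvPolynomial (Fin d) ℂ) : Continuous (polyEval P) :=
  (MvPolynomial.continuous_eval P).comp (PiLp.continuous_ofLp 2 _)

theorem continuous_polyDeriv (P : MvPolynomial (Fin d) ℂ) (v : EuclideanSpace ℂ (Fin d)) :
    Continuous fun q => polyDeriv P q v :=
  continuous_finsetSum _ fun _ _ => continuous_const.mul (continuous_polyEval _)

theorem hasDerivAt_polyEval (P : MvPolynomial (Fin d) ℂ) (q v : EuclideanSpace ℂ (Fin d))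
    (t : ℂ) : HasDerivAt (fun t : ℂ => polyEval P (q + t • v)) (polyDeriv P (q + t • v) v) t := by
  induction P using MvPolynomial.induction_on with
  | C a => simpa [polyEval, polyDeriv] using hasDerivAt_const t a
  | add P Q hP hQ =>
    refine (hP.add hQ).congr_deriv ?_ |>.congr_of_eventuallyEq (.of_forall fun x => ?_)
    · simp [polyEval, polyDeriv, mul_add, Finset.sum_add_distrib]
    · simp [polyEval]
  | mul_X P i hP =>
    have hX : HasDerivAt (fun t : ℂ => q i + t * v i) (v i) t := by
      simpa using ((hasDerivAt_id t).mul_const (v i)).const_add (q i)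
    refine (hP.mul hX).congr_deriv ?_ |>.congr_of_eventuallyEq (.of_forall fun x => ?_)
    · simp only [polyDeriv, polyEval, Derivation.leibniz, MvPolynomial.pderiv_X, smul_eq_mul,
        map_add, map_mul, MvPolynomial.eval_X, mul_add, Finset.sum_add_distrib, Finset.sum_mul,
        PiLp.add_apply, PiLp.smul_apply]
      rw [add_comm]
      congr 1
      · rw [Finset.sum_eq_single i]
        · simp; ring
        · intro j _ hj
          simp [hj.symm]
        · simp
      · rw [← Finset.sum_add_distrib]
        exact Finset.sum_congr rfl fun j _ => by ring
    · simp [polyEval]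

theorem norm_polyEval_le (P : MvPolynomial (Fin d) ℂ) {z : EuclideanSpace ℂ (Fin d)}
    (hz : ‖z‖ ≤ 1) : ‖polyEval P z‖ ≤ ‖polyFn P‖ := by
  have h := norm_evalAt_le ⟨z, mem_closedBall_zero_iff.2 hz⟩ (polyFn P)
  rwa [evalAt_polyFn] at h

theorem norm_polyDeriv_le (P : MvPolynomial (Fin d) ℂ) {q v : EuclideanSpace ℂ (Fin d)} {r : ℝ}
    (hr : 0 < r) (h : ∀ w : ℂ, ‖w‖ = r → ‖q + w • v‖ ≤ 1) :
    ‖polyDeriv P q v‖ ≤ ‖polyFn P‖ / r := by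
  have h0 := (hasDerivAt_polyEval P q v 0).deriv
  rw [zero_smul, add_zero] at h0
  rw [← h0]
  refine Complex.norm_deriv_le_of_forall_mem_sphere_norm_le hr ?_ fun w hw => ?_
  · exact Differentiable.diffContOnCl fun t => (hasDerivAt_polyEval P q v t).differentiableAt
  · exact norm_polyEval_le P (h w (mem_sphere_zero_iff_norm.1 hw))

theorem integral_polyDeriv (P : MvPolynomial (Fin d) ℂ) (p v : EuclideanSpace ℂ (Fin d)) :
    ∫ s in (0 : ℝ)..1, polyDeriv P (p + (s : ℂ) • v) v = polyEval P (p + v) - polyEval P p := by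
  have h := intervalIntegral.integral_eq_sub_of_hasDerivAt
    (f := fun s : ℝ => polyEval P (p + (s : ℂ) • v))
    (f' := fun s : ℝ => polyDeriv P (p + (s : ℂ) • v) v) (a := 0) (b := 1)
    (fun s _ => (hasDerivAt_polyEval P p v s).comp_ofReal)
    (Continuous.intervalIntegrable ((continuous_polyDeriv P v).comp (by fun_prop)) _ _)
  simpa using h

theorem norm_segment_add_le {p z τ : EuclideanSpace ℂ (Fin d)} (hp : ‖p‖ < 1) (hz : ‖z‖ ≤ 1)
    (hτ : inner ℂ z τ = 0) {s : ℝ} (hs : 0 ≤ s) (hs1 : s ≤ 1)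
    (hτ' : ‖τ‖ ^ 2 ≤ (1 - ‖p‖) ^ 2 * (1 - s)) :
    ‖p + (s : ℂ) • (z - p) + τ‖ ≤ 1 := by
  have h1 : p + (s : ℂ) • (z - p) + τ = ((1 - s : ℝ) : ℂ) • p + ((s : ℂ) • z + τ) := by
    push_cast; module
  have h2 : ‖(s : ℂ) • z + τ‖ * ‖(s : ℂ) • z + τ‖ = s ^ 2 * ‖z‖ ^ 2 + ‖τ‖ ^ 2 := by
    rw [norm_add_sq_eq_norm_sq_add_norm_sq_of_inner_eq_zero (𝕜 := ℂ), norm_smul,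
      Complex.norm_real, Real.norm_of_nonneg hs]
    · ring
    · rw [inner_smul_left, hτ, mul_zero]
  have hp0 := norm_nonneg p
  have h3 : ‖(s : ℂ) • z + τ‖ ≤ s + (1 - ‖p‖) * (1 - s) := by
    have h0 : 0 ≤ s + (1 - ‖p‖) * (1 - s) := by nlinarith
    have h4 : ‖z‖ ^ 2 ≤ 1 := by nlinarith [norm_nonneg z]
    have h5 : s ^ 2 * ‖z‖ ^ 2 ≤ s ^ 2 := by nlinarith [sq_nonneg s]
    refine abs_le_of_sq_le_sq' ?_ h0 |>.2
    have h6 : 0 ≤ (1 - ‖p‖) * (1 - s) * s * (1 + ‖p‖) := by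
      have := sub_nonneg.2 hp.le
      have := sub_nonneg.2 hs1
      positivity
    nlinarith
  rw [h1]
  refine (norm_add_le _ _).trans ?_
  rw [norm_smul, Complex.norm_real, Real.norm_of_nonneg (sub_nonneg.2 hs1)]
  nlinarith

theorem norm_integral_polyDeriv_le {p : EuclideanSpace ℂ (Fin d)} (hp : ‖p‖ < 1) :
    ∃ C : ℝ, 0 ≤ C ∧ ∀ (P : MvPolynomial (Fin d) ℂ) (z e : EuclideanSpace ℂ (Fin d)),
      ‖z‖ ≤ 1 → ‖e‖ ≤ 1 →
        ‖∫ s in (0 : ℝ)..1, polyDeriv P (p + (s : ℂ) • (z - p)) e‖ ≤ C * ‖polyFn P‖ := by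
  set m := 1 - ‖p‖ with hm
  have hm0 : 0 < m := sub_pos.2 hp
  have hp0 := norm_nonneg p
  set T := 1 + 4 / m with hT
  have hT0 : 0 < T := by positivity
  refine ⟨(4 + 2 * T) / m, by positivity, fun P z e hz he => ?_⟩
  set N := ‖polyFn P‖
  have hN : 0 ≤ N := norm_nonneg _
  rcases le_or_gt ‖z‖ (1 - m / 2) with hz1 | hz1
  · have h : ∀ s ∈ uIoc (0 : ℝ) 1, ‖polyDeriv P (p + (s : ℂ) • (z - p)) e‖ ≤ N / (m / 2) := by
      intro s hs
      rw [uIoc_of_le zero_le_one] at hs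
      refine norm_polyDeriv_le P (by positivity) fun w hw => ?_
      have h1 : p + (s : ℂ) • (z - p) = ((1 - s : ℝ) : ℂ) • p + (s : ℂ) • z := by
        push_cast; module
      rw [h1]
      refine (norm_add₃_le).trans ?_
      rw [norm_smul, norm_smul, norm_smul, Complex.norm_real, Complex.norm_real,
        Real.norm_of_nonneg hs.1.le, Real.norm_of_nonneg (sub_nonneg.2 hs.2), hw]
      nlinarith [mul_nonneg (sub_nonneg.2 hs.2) hm0.le, hs.1.le]
    refine (intervalIntegral.norm_integral_le_of_norm_le_const h).trans ?_
    rw [sub_zero, abs_one, mul_one, div_div_eq_mul_div, div_mul_eq_mul_div]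
    rw [div_le_div_iff_of_pos_right hm0]
    nlinarith
  · have hz0 : 0 < ‖z‖ := by linarith
    have h1 : ‖z‖ * (m / 2) ≤ ‖inner ℂ z (z - p)‖ := by
      rw [inner_sub_right]
      refine le_trans ?_ (norm_sub_norm_le _ _)
      rw [inner_self_eq_norm_sq_to_K, norm_pow, RCLike.norm_ofReal, abs_norm]
      nlinarith [norm_inner_le_norm (𝕜 := ℂ) z p]
    have h10 : 0 < ‖inner ℂ z (z - p)‖ := lt_of_lt_of_le (by positivity) h1
    set a : ℂ := inner ℂ z e / inner ℂ z (z - p) with ha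
    have ha1 : ‖a‖ ≤ 2 / m := by
      rw [ha, norm_div, div_le_iff₀ h10]
      calc ‖inner ℂ z e‖ ≤ ‖z‖ := (norm_inner_le_norm _ _).trans
            (mul_le_of_le_one_right hz0.le he)
        _ = 2 / m * (‖z‖ * (m / 2)) := by field_simp
        _ ≤ _ := by gcongr
    set τ := e - a • (z - p) with hτ
    have hzp : ‖z - p‖ ≤ 2 := (norm_sub_le _ _).trans (by linarith)
    have hτ0 : inner ℂ z τ = 0 := by
      rw [hτ, inner_sub_right, inner_smul_right, ha, div_mul_cancel₀ _ (norm_pos_iff.1 h10),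
        sub_self]
    have hτT : ‖τ‖ ≤ T := by
      refine (norm_sub_le _ _).trans ?_
      rw [norm_smul, hT]
      have : ‖a‖ * ‖z - p‖ ≤ 2 / m * 2 := by gcongr
      have h4 : 2 / m * 2 = 4 / m := by ring
      linarith
    have he' : e = a • (z - p) + τ := by rw [hτ]; module
    have hD : ∀ v, IntervalIntegrable (fun s : ℝ => polyDeriv P (p + (s : ℂ) • (z - p)) v)
        volume 0 1 := fun v =>
      Continuous.intervalIntegrable ((continuous_polyDeriv P v).comp (by fun_prop)) _ _
    have hsplit : ∫ s in (0 : ℝ)..1, polyDeriv P (p + (s : ℂ) • (z - p)) e =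
        a * (polyEval P z - polyEval P p) +
          ∫ s in (0 : ℝ)..1, polyDeriv P (p + (s : ℂ) • (z - p)) τ := by
      have h2 := integral_polyDeriv P p (z - p)
      rw [add_sub_cancel] at h2
      rw [← h2, ← intervalIntegral.integral_const_mul, ← intervalIntegral.integral_add
        ((hD _).const_mul a) (hD _)]
      refine intervalIntegral.integral_congr fun s _ => ?_
      rw [← polyDeriv_smul_add, ← he']
    have hint : IntervalIntegrable (fun s : ℝ => N * T / m * (1 - s) ^ (-(1 / 2) : ℝ))
        volume 0 1 := by
      have h3 : IntervalIntegrable (fun s : ℝ => s ^ (-(1 / 2) : ℝ)) volume 0 1 :=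
        intervalIntegral.intervalIntegrable_rpow' (by norm_num)
      have h4 := (h3.comp_sub_left 1).symm
      simp only [sub_zero, sub_self] at h4
      exact h4.const_mul _
    have hval : ∫ s in (0 : ℝ)..1, N * T / m * (1 - s) ^ (-(1 / 2) : ℝ) = N * T / m * 2 := by
      rw [intervalIntegral.integral_const_mul, intervalIntegral.integral_comp_sub_left
        (fun s : ℝ => s ^ (-(1 / 2) : ℝ)) 1, integral_rpow (Or.inl (by norm_num))]
      norm_num
    have hbd : ∀ᵐ s : ℝ, s ∈ Ioc (0 : ℝ) 1 → ‖polyDeriv P (p + (s : ℂ) • (z - p)) τ‖ ≤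
        N * T / m * (1 - s) ^ (-(1 / 2) : ℝ) := by
      filter_upwards [compl_mem_ae_iff.2 (measure_singleton (1 : ℝ))] with s hs1 hs
      have hs2 : 0 < 1 - s := sub_pos.2 (lt_of_le_of_ne hs.2 hs1)
      rw [Real.rpow_neg hs2.le, ← Real.sqrt_eq_rpow]
      have hq : 0 < √(1 - s) := Real.sqrt_pos.2 hs2
      have h5 : N * T / m * (√(1 - s))⁻¹ = N / (m * √(1 - s) / T) := by field_simp
      rw [h5]
      refine norm_polyDeriv_le P (by positivity) fun w hw => ?_
      refine norm_segment_add_le hp hz (by rw [inner_smul_right, hτ0, mul_zero]) hs.1.le hs.2 ?_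
      have h6 : ‖w • τ‖ ≤ m * √(1 - s) := by
        rw [norm_smul, hw, div_mul_eq_mul_div, div_le_iff₀ hT0]
        gcongr
      calc ‖w • τ‖ ^ 2 ≤ (m * √(1 - s)) ^ 2 := by gcongr
        _ = m ^ 2 * (1 - s) := by rw [mul_pow, Real.sq_sqrt hs2.le]
    have hlast := intervalIntegral.norm_integral_le_of_norm_le zero_le_one hbd hint
    rw [hval] at hlast
    rw [hsplit]
    refine (norm_add_le _ _).trans ?_
    have h7 : ‖a * (polyEval P z - polyEval P p)‖ ≤ 2 / m * (2 * N) := by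
      rw [norm_mul]
      gcongr
      refine (norm_sub_le _ _).trans ?_
      have := norm_polyEval_le P hz
      have := norm_polyEval_le P hp.le
      linarith
    have h8 : (4 + 2 * T) / m * N = 2 / m * (2 * N) + N * T / m * 2 := by ring
    linarith

theorem exists_gleason {p : CB d} (hp : p ∈ openD d) :
    ∃ C : ℝ, 0 ≤ C ∧ ∀ P : MvPolynomial (Fin d) ℂ, ∃ g : Fin d → ballAlgSub d,
      polyFn P - algebraMap ℂ _ (evalAt p (polyFn P)) =
        ∑ i, (coordFn i - algebraMap ℂ _ (p.1 i)) * g i ∧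
      ∀ i, ‖g i‖ ≤ C * ‖polyFn P‖ := by
  obtain ⟨C, hC, h⟩ := norm_integral_polyDeriv_le (p := p.1) hp
  refine ⟨C, hC, fun P => ?_⟩
  let G : MvPolynomial (Fin d) ℂ → ℝ → ballAlgSub d := fun Q s => MvPolynomial.aeval (fun j =>
    algebraMap ℂ (ballAlgSub d) (p.1 j) +
      (s : ℂ) • (coordFn j - algebraMap ℂ (ballAlgSub d) (p.1 j))) Q
  have hG : ∀ Q, Continuous (G Q) := by
    intro Q
    induction Q using MvPolynomial.induction_on with
    | C a => simpa [G] using continuous_const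
    | add P Q hP hQ =>
      simp only [G, map_add] at hP hQ ⊢
      exact hP.add hQ
    | mul_X P i hP =>
      simp only [G, map_mul, MvPolynomial.aeval_X]
      exact hP.mul (by fun_prop)
  have hGe : ∀ Q s (z : CB d), evalAt z (G Q s) =
      polyEval Q (p.1 + (s : ℂ) • (z.1 - p.1)) := by
    intro Q s z
    rw [polyEval, ← MvPolynomial.aeval_eq_eval]
    change ((evalAt z).comp (MvPolynomial.aeval _)) Q = _
    rw [MvPolynomial.comp_aeval]
    congr 2
  have hint : ∀ Q (z : CB d), evalAt z (∫ s in (0 : ℝ)..1, G Q s) =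
      ∫ s in (0 : ℝ)..1, polyEval Q (p.1 + (s : ℂ) • (z.1 - p.1)) := by
    intro Q z
    have h1 := ContinuousLinearMap.intervalIntegral_comp_comm
      (⟨(evalAt z).toLinearMap, continuous_evalAt z⟩ : ballAlgSub d →L[ℂ] ℂ)
      ((hG Q).intervalIntegrable (μ := volume) 0 1)
    rw [← intervalIntegral.integral_congr fun s _ => hGe Q s z]
    exact h1.symm
  refine ⟨fun i => ∫ s in (0 : ℝ)..1, G (MvPolynomial.pderiv i P) s, ?_, fun i => ?_⟩
  · refine eq_of_evalAt_eq fun z => ?_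
    rw [map_sub, AlgHom.commutes, map_sum, evalAt_polyFn, evalAt_polyFn]
    have h2 := integral_polyDeriv P p.1 (z.1 - p.1)
    rw [add_sub_cancel] at h2
    refine h2.symm.trans ?_
    simp only [polyDeriv]
    rw [intervalIntegral.integral_finsetSum]
    · refine Finset.sum_congr rfl fun i _ => ?_
      rw [map_mul, hint, intervalIntegral.integral_const_mul, map_sub, evalAt_coordFn,
        AlgHom.commutes]
      rfl
    · intro i _
      exact Continuous.intervalIntegrable
        (continuous_const.mul ((continuous_polyEval _).comp (by fun_prop))) _ _
  · refine norm_le_of_norm_evalAt_le (by positivity) fun z => ?_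
    rw [hint]
    have h3 := h P z.1 (EuclideanSpace.single i 1) (mem_closedBall_zero_iff.1 z.2) (by simp)
    simpa only [polyDeriv_single] using h3

end Gleason

section EssentialSpectrum

variable {d : ℕ}

/-- The ideal of the functions in the ball algebra that vanish on `X`. -/
def vanishIdeal (X : Set (CB d)) : Ideal (ballAlgSub d) where
  carrier := {f | ∀ z ∈ X, evalAt z f = 0}
  add_mem' hf hg z hz := by rw [map_add, hf z hz, hg z hz, add_zero]
  zero_mem' z _ := map_zero _
  smul_mem' c f hf z hz := by rw [smul_eq_mul, map_mul, hf z hz, mul_zero]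

theorem evalAt_eq_zero_of_mem_vanishIdeal {X : Set (CB d)} {z : CB d} (hz : z ∈ ZS d (IX d X))
    {f : ballAlgSub d} (hf : f ∈ vanishIdeal X) : evalAt z f = 0 := hz f ⟨f.2, hf⟩

theorem norm_le_gleason {p : CB d} (hp : p ∈ openD d) : ∃ C : ℝ, 0 ≤ C ∧
    ∀ ℓ : ballAlgSub d →L[ℂ] ℂ, ‖ℓ‖ ≤ 1 * ‖ℓ 1‖ +
      C * ∑ i, ‖dualAct (coordFn i - algebraMap ℂ _ (p.1 i)) ℓ‖ := by
  obtain ⟨C, hC, h⟩ := exists_gleason hp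
  refine ⟨C, hC, fun ℓ => ?_⟩
  set S := 1 * ‖ℓ 1‖ + C * ∑ i, ‖dualAct (coordFn i - algebraMap ℂ _ (p.1 i)) ℓ‖ with hS
  refine ℓ.opNorm_le_bound (by positivity) fun f => ?_
  refine denseRange_polyFn.induction_on
    (p := fun f : ballAlgSub d => ‖ℓ f‖ ≤ S * ‖f‖) f
    (isClosed_le (by fun_prop) (by fun_prop)) fun P => ?_
  obtain ⟨g, hg, hgC⟩ := h P
  rw [sub_eq_iff_eq_add] at hg
  have h1 : ℓ (polyFn P) = ∑ i, dualAct (coordFn i - algebraMap ℂ _ (p.1 i)) ℓ (g i) +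
      evalAt p (polyFn P) * ℓ 1 := by
    conv_lhs => rw [hg]
    rw [map_add, map_sum, Algebra.algebraMap_eq_smul_one (evalAt p (polyFn P)), map_smul,
      smul_eq_mul]
    rfl
  rw [h1]
  refine (norm_add_le _ _).trans ?_
  rw [norm_mul, hS, add_mul, add_comm, one_mul]
  refine add_le_add ?_ ?_
  · rw [mul_comm]
    gcongr
    exact norm_evalAt_le _ _
  · rw [Finset.mul_sum, Finset.sum_mul]
    refine norm_sum_le_of_le _ fun i _ => (ContinuousLinearMap.le_opNorm _ _).trans ?_
    calc _ ≤ ‖dualAct (coordFn i - algebraMap ℂ _ (p.1 i)) ℓ‖ * (C * ‖polyFn P‖) := by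
          gcongr; exact hgC i
      _ = _ := by ring

theorem exists_essNorm_le_sum (J : Ideal (ballAlgSub d)) {p : CB d} (hp : p ∈ openD d) :
    ∃ C : ℝ, 0 ≤ C ∧ ∀ u, essNorm J u ≤
      C * ∑ i, essNorm J (u * (coordFn i - algebraMap ℂ _ (p.1 i))) := by
  obtain ⟨C, hC, h⟩ := norm_le_gleason hp
  exact ⟨C, hC, essNorm_le_mul_sum J _ zero_le_one hC h⟩

/-- The points of the ball whose evaluations are bounded by the essential seminorm. -/
def essSpec (J : Ideal (ballAlgSub d)) : Set (CB d) := {z | ∀ f, ‖evalAt z f‖ ≤ essNorm J f}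

theorem isCompact_essSpec (J : Ideal (ballAlgSub d)) : IsCompact (essSpec J) := by
  refine IsClosed.isCompact ?_
  simp only [essSpec, ofPred_forall]
  exact isClosed_iInter fun f =>
    isClosed_le (f : C(CB d, ℂ)).continuous.norm continuous_const

theorem essSpec_vanishIdeal_subset (X : Set (CB d)) :
    essSpec (vanishIdeal X) ⊆ ZS d (IX d X) := by
  intro z hz φ hφ
  have h1 : (⟨φ, hφ.1⟩ : ballAlgSub d) ∈ vanishIdeal X := hφ.2
  have h2 := hz ⟨φ, hφ.1⟩
  rw [essNorm_eq_zero_of_mem h1] at h2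
  exact norm_le_zero_iff.1 h2

theorem essNorm_pow_le (J : Ideal (ballAlgSub d)) (f : ballAlgSub d) {k : ℕ} (hk : 0 < k) :
    essNorm J (f ^ k) ≤ essNorm J f ^ k := by
  induction k, hk using Nat.le_induction with
  | base => simp
  | succ k _ ih =>
    rw [pow_succ, pow_succ]
    exact (essNorm_mul_le J _ _).trans (mul_le_mul_of_nonneg_right ih (essNorm_nonneg J f))

/-- Evaluation at a point of the closed ball as an element of the character space. -/
def evalChar (z : CB d) : WeakDual.characterSpace ℂ (ballAlgSub d) :=
  WeakDual.CharacterSpace.equivAlgHom.symm (evalAt z)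

@[simp] theorem evalChar_apply (z : CB d) (f : ballAlgSub d) : evalChar z f = evalAt z f := rfl

theorem evalChar_injective : Function.Injective (evalChar (d := d)) := fun z w h =>
  Subtype.ext (PiLp.ext fun i => by
    rw [← evalAt_coordFn z, ← evalAt_coordFn w, ← evalChar_apply, h, evalChar_apply])

theorem norm_evalAt_le_two_mul_essNorm {X : Set (CB d)} {lam : CB d}
    (hlam : lam ∈ ZS d (IX d X) ∩ openD d)
    (hiso : ¬ IsIsolatedIn d (ZS d (IX d X) ∩ openD d) lam) (f : ballAlgSub d) :
    ‖evalAt lam f‖ ≤ 2 * essNorm (vanishIdeal X) f := by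
  refine le_of_forall_lt_imp_le_of_dense fun c hc => ?_
  set A := ZS d (IX d X) ∩ openD d with hA
  set U : Set (CB d) := {z | c < ‖evalAt z f‖}
  have hU : IsOpen U := isOpen_lt continuous_const (f : C(CB d, ℂ)).continuous.norm
  have hinf : (U ∩ A).Infinite := by
    intro hfin
    refine hiso ⟨hlam, U \ ((U ∩ A) \ {lam}), hU.sdiff hfin.sdiff.isClosed, ?_⟩
    ext z
    simp only [mem_inter_iff, Set.mem_sdiff, mem_singleton_iff, not_and, not_not]
    constructor
    · rintro ⟨⟨h1, h2⟩, h3⟩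
      exact h2 ⟨h1, h3⟩
    · rintro rfl
      exact ⟨⟨hc, fun _ => rfl⟩, hlam⟩
  let e := Set.Infinite.natEmbedding _ hinf
  let z : ℕ → CB d := fun n => (e n).1
  have hz : ∀ n, z n ∈ U ∩ A := fun n => (e n).2
  have he : Function.Injective fun n => evalChar (z n) :=
    evalChar_injective.comp (Subtype.val_injective.comp e.injective)
  have hJ : ∀ n, ∀ g ∈ vanishIdeal X, evalChar (z n) g = 0 := fun n g hg =>
    evalAt_eq_zero_of_mem_vanishIdeal (hz n).2.1 hg
  exact le_essNorm_of_injective (A := ballAlgSub d) he hJ fun n => (hz n).1.le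

theorem mem_essSpec_of_not_isolated {X : Set (CB d)} {lam : CB d}
    (hlam : lam ∈ ZS d (IX d X) ∩ openD d)
    (hiso : ¬ IsIsolatedIn d (ZS d (IX d X) ∩ openD d) lam) :
    lam ∈ essSpec (vanishIdeal X) := by
  intro f
  refine le_of_forall_pow_le_mul_pow (C := 2) (essNorm_nonneg _ _) fun k hk => ?_
  rw [← norm_pow, ← map_pow]
  refine (norm_evalAt_le_two_mul_essNorm hlam hiso _).trans ?_
  gcongr
  exact essNorm_pow_le _ f hk

theorem exists_essNorm_pow_le (J : Ideal (ballAlgSub d)) {f : ballAlgSub d} {c c' : ℝ}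
    (hc : 0 ≤ c) (hcc' : c < c') (h : ∀ z ∈ essSpec J, ‖evalAt z f‖ ≤ c) :
    ∃ K, ∀ k : ℕ, essNorm J (f ^ k) ≤ K * c' ^ k := by
  refine exists_seminorm_pow_le_of_forall_character (essNorm J) (essNorm_zero J)
    (essNorm_nonneg J) (essNorm_add_le J) (essNorm_mul_le J) (essNorm_smul_le J) hc hcc'
    fun χ hχ => ?_
  obtain ⟨z, rfl⟩ := exists_eq_evalAt fun f =>
    (hχ f).trans (essNorm_le (finiteCover_norm J f))
  exact h z hχ

end EssentialSpectrum

section MaximumPrinciple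

theorem essNorm_prod_le {A : Type*} [NormedCommRing A] [NormedAlgebra ℂ A] (J : Ideal A)
    {ι : Type*} (s : Finset ι) (f : ι → A) :
    essNorm J (∏ i ∈ s, f i) ≤ essNorm J 1 * ∏ i ∈ s, essNorm J (f i) := by
  classical
  induction s using Finset.induction_on with
  | empty => simp
  | insert i s hi ih =>
    rw [Finset.prod_insert hi, Finset.prod_insert hi, mul_left_comm]
    exact (essNorm_mul_le J _ _).trans (mul_le_mul_of_nonneg_left ih (essNorm_nonneg J _))

theorem exists_essNorm_pow_le_of_sum {A : Type*} [NormedCommRing A] [NormedAlgebra ℂ A]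
    (J : Ideal A) {ι : Type*} [Fintype ι] {y : ι → A} {C δ : ℝ} (hC : 0 ≤ C) {G : A}
    (hy : ∀ u, essNorm J u ≤ C * ∑ i, essNorm J (u * y i))
    (hG : ∀ i, ∃ K, ∀ k : ℕ, essNorm J ((G * y i) ^ k) ≤ K * δ ^ k) :
    ∃ K, ∀ k : ℕ, essNorm J (G ^ k) ≤ K * (C * Fintype.card ι * δ) ^ k := by
  classical
  choose K hK using hG
  set K₀ := essNorm J 1 * ∏ i, K i with hK₀
  have key : ∀ (k : ℕ) (α : ι → ℕ), essNorm J ((∏ i, (G * y i) ^ α i) * G ^ k) ≤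
      (C * Fintype.card ι) ^ k * (K₀ * δ ^ (∑ i, α i + k)) := by
    intro k
    induction k with
    | zero =>
      intro α
      rw [pow_zero, mul_one, pow_zero, one_mul, add_zero]
      refine (essNorm_prod_le J _ _).trans ?_
      rw [hK₀, ← Finset.prod_pow_eq_pow_sum, mul_assoc, ← Finset.prod_mul_distrib]
      exact mul_le_mul_of_nonneg_left
        (Finset.prod_le_prod (fun _ _ => essNorm_nonneg J _) fun i _ => hK i _)
        (essNorm_nonneg J _)
    | succ k ih =>
      intro α
      have h1 : ∀ i, (∏ j, (G * y j) ^ α j) * G ^ (k + 1) * y i =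
          (∏ j, (G * y j) ^ (α + Pi.single i 1 : ι → ℕ) j) * G ^ k := by
        intro i
        have h2 : ∏ j, (G * y j) ^ (Pi.single i 1 : ι → ℕ) j = G * y i := by
          rw [Finset.prod_eq_single i]
          · simp
          · intro j _ hj
            simp [hj]
          · simp
        simp only [Pi.add_apply, pow_add, Finset.prod_mul_distrib, h2]
        ring
      have h3 : ∀ i, ∑ j, (α + Pi.single i 1 : ι → ℕ) j + k = ∑ j, α j + (k + 1) := by
        intro i
        simp only [Pi.add_apply, Finset.sum_add_distrib, Pi.single_apply, Finset.sum_ite_eq',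
          Finset.mem_univ, if_true]
        ring
      refine (hy _).trans ?_
      calc C * ∑ i, essNorm J ((∏ j, (G * y j) ^ α j) * G ^ (k + 1) * y i)
          ≤ C * ∑ _i : ι, (C * Fintype.card ι) ^ k * (K₀ * δ ^ (∑ j, α j + (k + 1))) := by
            gcongr with i
            rw [h1 i, ← h3 i]
            exact ih _
        _ = _ := by
            rw [Finset.sum_const, Finset.card_univ, nsmul_eq_mul]
            ring
  refine ⟨K₀, fun k => ?_⟩
  have h := key k 0
  simp only [Pi.zero_apply, pow_zero, Finset.prod_const_one, one_mul, Finset.sum_const_zero,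
    zero_add] at h
  rw [mul_pow]
  linarith

variable {d : ℕ}

theorem evalAt_exp (z : CB d) (h : ballAlgSub d) :
    evalAt z (NormedSpace.exp h) = Complex.exp (evalAt z h) := by
  rw [Complex.exp_eq_exp_ℂ]
  refine NormedSpace.map_exp_of_mem_ball (𝕂 := ℂ) (evalAt z) (continuous_evalAt z) h ?_
  rw [NormedSpace.expSeries_radius_eq_top ℂ (ballAlgSub d)]
  exact edist_lt_top _ _

theorem mul_exp_neg_mul_sq_le {a η x : ℝ} (hη : 0 < η) (ha : 1 / (4 * η ^ 2) ≤ a) :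
    x * Real.exp (-(a * x ^ 2)) ≤ η := by
  have h1 : x / η ≤ Real.exp (a * x ^ 2) := by
    refine le_trans ?_ (Real.add_one_le_exp _)
    have h2 : 1 / (4 * η ^ 2) * x ^ 2 ≤ a * x ^ 2 := by gcongr
    have h3 : 1 / (4 * η ^ 2) * x ^ 2 = (x / η / 2) ^ 2 := by
      field_simp
      norm_num
      ring
    nlinarith [sq_nonneg (x / η / 2 - 1)]
  rw [Real.exp_neg, ← div_eq_mul_inv, div_le_iff₀ (Real.exp_pos _)]
  rwa [div_le_iff₀' hη] at h1

theorem exists_re_le_neg_norm_sub_sq {M : Set (CB d)} {p : CB d} {φ : ballAlgSub d} {ε : ℝ}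
    (hmax : ∀ z ∈ M, (evalAt z φ).re + ε * ‖z.1‖ ^ 2 ≤ (evalAt p φ).re + ε * ‖p.1‖ ^ 2) :
    ∃ h : ballAlgSub d, evalAt p h = 0 ∧
      ∀ z ∈ M, (evalAt z h).re ≤ -(ε * ‖z.1 - p.1‖ ^ 2) := by
  let h : ballAlgSub d := φ - algebraMap ℂ _ (evalAt p φ) +
    ∑ i, ((2 * ε : ℝ) * starRingEnd ℂ (p.1 i)) • (coordFn i - algebraMap ℂ _ (p.1 i))
  have hh : ∀ z : CB d, evalAt z h =
      evalAt z φ - evalAt p φ + (2 * ε : ℝ) * inner ℂ p.1 (z.1 - p.1) := by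
    intro z
    rw [map_add, map_sub, AlgHom.commutes, map_sum, PiLp.inner_apply, Finset.mul_sum]
    congr 1
    refine Finset.sum_congr rfl fun i _ => ?_
    rw [map_smul, map_sub, AlgHom.commutes, evalAt_coordFn, RCLike.inner_apply, smul_eq_mul,
      mul_assoc, mul_comm (starRingEnd ℂ _)]
    rfl
  refine ⟨h, by simp [hh], fun z hz => ?_⟩
  rw [hh, Complex.add_re, Complex.sub_re, Complex.re_ofReal_mul]
  have h1 := norm_add_sq (𝕜 := ℂ) p.1 (z.1 - p.1)
  rw [add_sub_cancel] at h1
  have h2 := hmax z hz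
  rw [h1] at h2
  change _ + 2 * ε * (RCLike.re (inner ℂ p.1 (z.1 - p.1))) ≤ _
  linarith

theorem not_forall_re_add_le {J : Ideal (ballAlgSub d)} {p : CB d} (hp : p ∈ openD d)
    (hpM : p ∈ essSpec J) {φ : ballAlgSub d} {ε : ℝ} (hε : 0 < ε) :
    ¬ ∀ z ∈ essSpec J, (evalAt z φ).re + ε * ‖z.1‖ ^ 2 ≤ (evalAt p φ).re + ε * ‖p.1‖ ^ 2 := by
  intro hmax
  obtain ⟨h, hp0, hM⟩ := exists_re_le_neg_norm_sub_sq hmax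
  obtain ⟨C, hC, hy⟩ := exists_essNorm_le_sum J hp
  set η : ℝ := 1 / (4 * (C * d + 1)) with hη
  have hη0 : 0 < η := by positivity
  obtain ⟨n, hn⟩ := exists_nat_ge (1 / (4 * η ^ 2) / ε)
  rw [div_le_iff₀ hε] at hn
  set G : ballAlgSub d := NormedSpace.exp h ^ n with hGdef
  have hG : ∀ i, ∃ K, ∀ k : ℕ,
      essNorm J ((G * (coordFn i - algebraMap ℂ _ (p.1 i))) ^ k) ≤ K * (2 * η) ^ k := by
    intro i
    refine exists_essNorm_pow_le J hη0.le (by linarith) fun z hz => ?_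
    rw [map_mul, hGdef, map_pow, evalAt_exp, map_sub, AlgHom.commutes, evalAt_coordFn, norm_mul,
      norm_pow, Complex.norm_exp, ← Real.exp_nat_mul, mul_comm]
    refine le_trans ?_ (mul_exp_neg_mul_sq_le hη0 (x := ‖z.1 - p.1‖) hn)
    refine mul_le_mul (PiLp.norm_apply_le (z.1 - p.1) i) (Real.exp_le_exp.2 ?_)
      (Real.exp_pos _).le (norm_nonneg _)
    have := mul_le_mul_of_nonneg_left (hM z hz) n.cast_nonneg
    linarith
  obtain ⟨K, hK⟩ := exists_essNorm_pow_le_of_sum J hC hy hG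
  have h1 : (1 : ℝ) ≤ C * Fintype.card (Fin d) * (2 * η) :=
    le_of_forall_pow_le_mul_pow (C := K) (by positivity) fun k _ => by
      refine le_trans ?_ (hK k)
      refine le_trans ?_ (hpM _)
      rw [hGdef, map_pow, map_pow, evalAt_exp, hp0]
      simp
  rw [Fintype.card_fin, hη] at h1
  have h2 : C * d * (2 * (1 / (4 * (C * d + 1)))) = C * d / (2 * (C * d + 1)) := by
    field_simp; norm_num
  have h3 : 0 ≤ C * d := by positivity
  rw [h2, le_div_iff₀ (by positivity)] at h1
  linarith

/-- The maximum principle: real parts of functions in the ball algebra are dominated at points of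
the essential spectrum by their values on the part of it lying on the sphere. -/
theorem re_evalAt_le_of_sphere {J : Ideal (ballAlgSub d)} {lam : CB d} (hlam : lam ∈ essSpec J)
    {φ : ballAlgSub d} {s : ℝ} (hs : ∀ z ∈ essSpec J ∩ sphereD d, (evalAt z φ).re ≤ s) :
    (evalAt lam φ).re ≤ s := by
  refine le_of_forall_pos_le_add fun ε hε => ?_
  have hcont : Continuous fun z : CB d => (evalAt z φ).re + ε * ‖z.1‖ ^ 2 := by
    have h1 : Continuous fun z : CB d => evalAt z φ := (φ : C(CB d, ℂ)).continuous
    fun_prop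
  obtain ⟨p, hpM, hp⟩ := (isCompact_essSpec J).exists_isMaxOn ⟨lam, hlam⟩ hcont.continuousOn
  rcases (mem_closedBall_zero_iff.1 p.2).lt_or_eq with h1 | h1
  · exact absurd (fun z hz => hp hz) (not_forall_re_add_le h1 hpM hε)
  · have h2 : (evalAt lam φ).re + ε * ‖lam.1‖ ^ 2 ≤ (evalAt p φ).re + ε * ‖p.1‖ ^ 2 := hp hlam
    have h3 := hs p ⟨hpM, h1⟩
    rw [h1] at h2
    nlinarith [mul_nonneg hε.le (sq_nonneg ‖lam.1‖)]

end MaximumPrinciple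

section RepresentingMeasure

/-- A positive linear functional on the continuous functions on a compact space is given by a
finite regular measure. -/
theorem exists_measure_of_positive {Y : Type*} [TopologicalSpace Y] [T2Space Y] [CompactSpace Y]
    [MeasurableSpace Y] [BorelSpace Y] (g : C(Y, ℝ) →ₗ[ℝ] ℝ) (hg : ∀ u, 0 ≤ u → 0 ≤ g u) :
    ∃ μ : Measure Y, IsFiniteMeasure μ ∧ μ.Regular ∧ ∀ u : C(Y, ℝ), ∫ y, u y ∂μ = g u := by
  let Λ : CompactlySupportedContinuousMap Y ℝ →ₚ[ℝ] ℝ := PositiveLinearMap.mk₀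
    { toFun := fun u => g u.toContinuousMap
      map_add' := fun u v => map_add g u.toContinuousMap v.toContinuousMap
      map_smul' := fun c u => map_smul g c u.toContinuousMap }
    fun u hu => hg _ hu
  have hreg : (RealRMK.rieszMeasure Λ).Regular := inferInstance
  refine ⟨RealRMK.rieszMeasure Λ, CompactSpace.isFiniteMeasure, hreg, fun u => ?_⟩
  exact RealRMK.integral_rieszMeasure Λ (CompactlySupportedContinuousMap.continuousMapEquiv u)

theorem exists_measure_of_le_on {Y : Type*} [MetricSpace Y] [CompactSpace Y]
    [MeasurableSpace Y] [BorelSpace Y] {K : Set Y} (hK : IsClosed K) (hne : K.Nonempty)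
    (W : Submodule ℝ C(Y, ℝ)) (y₀ : Y)
    (hW : ∀ u ∈ W, ∀ s : ℝ, (∀ y ∈ K, u y ≤ s) → u y₀ ≤ s) :
    ∃ μ : Measure Y, IsFiniteMeasure μ ∧ μ.Regular ∧ μ Kᶜ = 0 ∧
      ∀ u ∈ W, ∫ y, u y ∂μ = u y₀ := by
  have hbdd : ∀ u : C(Y, ℝ), BddAbove (u '' K) := fun u =>
    (hK.isCompact.image u.continuous).bddAbove
  have hle : ∀ (u : C(Y, ℝ)), ∀ y ∈ K, u y ≤ sSup (u '' K) := fun u y hy =>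
    le_csSup (hbdd u) (mem_image_of_mem u hy)
  have hsup : ∀ (u : C(Y, ℝ)) (s : ℝ), (∀ y ∈ K, u y ≤ s) → sSup (u '' K) ≤ s := fun u s h =>
    csSup_le (hne.image u) (forall_mem_image.2 h)
  let f : C(Y, ℝ) →ₗ.[ℝ] ℝ :=
    { domain := W
      toFun := (ContinuousMap.evalAlgHom ℝ ℝ y₀).toLinearMap.comp W.subtype }
  have hhom : ∀ c : ℝ, 0 < c → ∀ u : C(Y, ℝ),
      sSup ((c • u : C(Y, ℝ)) '' K) = c * sSup (u '' K) := by
    intro c hc u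
    refine le_antisymm (hsup _ _ fun y hy => ?_) ?_
    · exact mul_le_mul_of_nonneg_left (hle u y hy) hc.le
    · rw [← le_div_iff₀' hc]
      refine hsup _ _ fun y hy => ?_
      rw [le_div_iff₀' hc]
      exact hle (c • u) y hy
  have hsub : ∀ u v : C(Y, ℝ), sSup ((u + v : C(Y, ℝ)) '' K) ≤ sSup (u '' K) + sSup (v '' K) :=
    fun u v => hsup _ _ fun y hy => add_le_add (hle u y hy) (hle v y hy)
  obtain ⟨g, hgf, hg⟩ := exists_extension_of_le_sublinear f (fun u => sSup (u '' K)) hhom hsub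
    fun u => hW u.1 u.2 _ (hle u.1)
  obtain ⟨μ, hfin, hreg, hμ⟩ := exists_measure_of_positive g fun u hu => by
    have h1 : g (-u) ≤ 0 := (hg (-u)).trans (hsup _ _ fun y _ => neg_nonpos.2 (hu y))
    rwa [map_neg, neg_nonpos] at h1
  refine ⟨μ, hfin, hreg, ?_, fun u hu => (hμ u).trans (hgf ⟨u, hu⟩)⟩
  let δ : C(Y, ℝ) := ⟨fun y => infDist y K, continuous_infDist_pt K⟩
  have hδ : ∫ y, δ y ∂μ = 0 := by
    refine le_antisymm ?_ (integral_nonneg fun y => infDist_nonneg)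
    rw [hμ]
    exact (hg δ).trans (hsup _ _ fun y hy => (infDist_zero_of_mem hy).le)
  have hδ' := (integral_eq_zero_iff_of_nonneg (f := ⇑δ) (fun y => infDist_nonneg)
    (δ.continuous.integrable_of_hasCompactSupport (.of_compactSpace _))).1 hδ
  refine measure_mono_null (fun y hy => ?_) (ae_iff.1 hδ')
  exact fun h => hy ((hK.mem_iff_infDist_zero hne).2 h)

variable {d : ℕ}

/-- The real parts of the functions in the ball algebra. -/
def reBallAlg (d : ℕ) : Submodule ℝ C(CB d, ℝ) where
  carrier := {u | ∃ φ : ballAlgSub d, ∀ z, u z = (evalAt z φ).re}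
  add_mem' := by
    rintro u v ⟨φ, hφ⟩ ⟨ψ, hψ⟩
    exact ⟨φ + ψ, fun z => by simp [hφ, hψ]⟩
  zero_mem' := ⟨0, fun z => by simp⟩
  smul_mem' := by
    rintro c u ⟨φ, hφ⟩
    exact ⟨(c : ℂ) • φ, fun z => by simp [hφ]⟩

theorem isRepMeasure_of_re {lam : CB d} {μ : Measure (CB d)} (hfin : IsFiniteMeasure μ)
    (hreg : μ.Regular) (h : ∀ u ∈ reBallAlg d, ∫ z, u z ∂μ = u lam) : IsRepMeasure d lam μ := by
  refine ⟨hfin, hreg, fun φ hφ => ?_⟩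
  have hre : ∀ ψ : ballAlgSub d, ∫ z, (evalAt z ψ).re ∂μ = (evalAt lam ψ).re := fun ψ =>
    h ⟨fun z => (evalAt z ψ).re, Complex.continuous_re.comp (ψ : C(CB d, ℂ)).continuous⟩
      ⟨ψ, fun _ => rfl⟩
  have hint : Integrable φ μ :=
    φ.continuous.integrable_of_hasCompactSupport (.of_compactSpace _)
  have h1 := hre ⟨φ, hφ⟩
  have h2 := hre (-Complex.I • ⟨φ, hφ⟩)
  simp only [map_smul, evalAt_apply, smul_eq_mul, neg_mul, Complex.neg_re, Complex.I_mul_re,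
    neg_neg] at h1 h2
  refine Complex.ext ?_ ?_
  · rw [← h1]
    exact integral_re hint
  · rw [← h2]
    exact integral_im hint

end RepresentingMeasure

/-- a non-isolated point of `Z(I(X)) ∩ 𝔹_d` has a representing measure
supported on `Z(I(X)) ∩ 𝕊_d`. -/
theorem stmt2 (d : ℕ) (hd : 1 ≤ d) (X : Set (CB d)) (lam : CB d)
    (hlam : lam ∈ ZS d (IX d X) ∩ openD d)
    (hiso : ¬ IsIsolatedIn d (ZS d (IX d X) ∩ openD d) lam) :
    ∃ μ : Measure (CB d), IsRepMeasure d lam μ ∧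
      μ (ZS d (IX d X) ∩ sphereD d)ᶜ = 0 := by
  have hZ : IsClosed (ZS d (IX d X)) := by
    have : ZS d (IX d X) = ⋂ φ ∈ IX d X, {z : CB d | φ z = 0} := by
      ext z
      simp [ZS]
    rw [this]
    exact isClosed_biInter fun φ _ => isClosed_eq φ.continuous continuous_const
  have hS : IsClosed (sphereD d) := isClosed_eq (by fun_prop) continuous_const
  have hess := mem_essSpec_of_not_isolated hlam hiso
  have hsub := essSpec_vanishIdeal_subset X
  have hne : (ZS d (IX d X) ∩ sphereD d).Nonempty := by
    by_contra! hempty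
    have := re_evalAt_le_of_sphere hess (φ := 0) (s := -1) fun z hz =>
      absurd (show z ∈ ZS d (IX d X) ∩ sphereD d from ⟨hsub hz.1, hz.2⟩) (by simp [hempty])
    norm_num at this
  obtain ⟨μ, hfin, hreg, hμ, h⟩ := exists_measure_of_le_on (hZ.inter hS) hne (reBallAlg d) lam (by
    rintro u ⟨φ, hφ⟩ s hs
    rw [hφ]
    exact re_evalAt_le_of_sphere hess fun z hz => hφ z ▸ hs z ⟨hsub hz.1, hz.2⟩)
  exact ⟨μ, isRepMeasure_of_re hfin hreg h, hμ⟩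

end
end

section
/- Let X ⊆ cl(𝔹_d) and let z be an isolated point of Z(I(X)) ∩ 𝔹_d. Then there exists φ ∈ A(𝔹_d) such that φ(z) = 1 and φ(w) = 0 for every w ∈ Z(I(X)) \ {z}. -/
open MeasureTheory Metric Set Filter Topology

noncomputable section

/-! ### Finitely generated maximal ideals in commutative Banach algebras -/

section BanachAlgebra

variable {A : Type*} [NormedCommRing A] [NormedAlgebra ℂ A] {ι : Type} [Fintype ι]

/-- The monomial with exponents `e` in the elements `T i`. -/
def monom (T : ι → A) (e : ι → ℕ) : A := ∏ i, T i ^ e i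

/-- The complex span of the monomials of degree less than `n` in the elements `T i`. -/
def lowSpan (T : ι → A) (n : ℕ) : Submodule ℂ A :=
  Submodule.span ℂ (monom T '' {e | ∑ i, e i < n})

/-- Every element is a scalar plus an element of the ideal generated by the `T i`. -/
def GeneratesModScalars (T : ι → A) : Prop :=
  ∀ f : A, ∃ (c : ℂ) (g : ι → A), f = algebraMap ℂ A c + ∑ i, T i * g i

theorem monom_mem_lowSpan (T : ι → A) {n : ℕ} {e : ι → ℕ} (he : ∑ i, e i < n) :
    monom T e ∈ lowSpan T n :=
  Submodule.subset_span ⟨e, he, rfl⟩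

theorem lowSpan_mono (T : ι → A) {m n : ℕ} (h : m ≤ n) : lowSpan T m ≤ lowSpan T n :=
  Submodule.span_mono (image_mono fun _ he => lt_of_lt_of_le he h)

instance (T : ι → A) (n : ℕ) : FiniteDimensional ℂ (lowSpan T n) := by
  refine FiniteDimensional.span_of_finite ℂ (Set.Finite.image _ ?_)
  refine (Set.Finite.pi' fun _ : ι => Set.finite_Iic n).subset fun e he i => ?_
  exact (Finset.single_le_sum (fun _ _ => Nat.zero_le _) (Finset.mem_univ i)).trans
    (le_of_lt he)

omit [NormedAlgebra ℂ A] in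
theorem monom_add_single [DecidableEq ι] (T : ι → A) (e : ι → ℕ) (i : ι) :
    monom T (e + Pi.single i 1) = monom T e * T i := by
  simp only [monom, Pi.add_apply, pow_add, Finset.prod_mul_distrib]
  congr 1
  rw [Finset.prod_eq_single i] <;> simp +contextual

omit [NormedAlgebra ℂ A] in
theorem monom_mem_pow (T : ι → A) (e : ι → ℕ) :
    monom T e ∈ Ideal.span (range T) ^ (∑ i, e i) := by
  rw [monom, ← Finset.prod_pow_eq_pow_sum]
  exact Ideal.prod_mem_prod fun i _ =>
    Ideal.pow_mem_pow (Ideal.subset_span (mem_range_self i)) _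

theorem exists_monom_expansion (T : ι → A) {C : ℝ} (hC : 0 ≤ C)
    (h : ∀ f : A, ∃ (c : ℂ) (g : ι → A), f = algebraMap ℂ A c + ∑ i, T i * g i ∧
      ∀ i, ‖g i‖ ≤ C * ‖f‖) (n : ℕ) (f : A) :
    ∃ (κ : Type) (_ : Fintype κ) (e : κ → ι → ℕ) (g : κ → A),
      Fintype.card κ = Fintype.card ι ^ n ∧ (∀ k, ∑ i, e k i = n) ∧
      f - ∑ k, monom T (e k) * g k ∈ lowSpan T n ∧ ∀ k, ‖g k‖ ≤ C ^ n * ‖f‖ := by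
  classical
  induction n with
  | zero =>
    refine ⟨Unit, inferInstance, fun _ _ => 0, fun _ => f, by simp, by simp, ?_, by simp⟩
    simp [monom]
  | succ n ih =>
    obtain ⟨κ, _, e, g, hcard, he, hf, hg⟩ := ih
    choose c g' hg' hn using fun k => h (g k)
    refine ⟨κ × ι, inferInstance, fun p => e p.1 + Pi.single p.2 1, fun p => g' p.1 p.2,
      by simp [hcard, pow_succ], fun p => ?_, ?_, fun p => ?_⟩
    · simp [Finset.sum_add_distrib, he]
    · have key : f - ∑ p : κ × ι, monom T (e p.1 + Pi.single p.2 1) * g' p.1 p.2 =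
          (f - ∑ k, monom T (e k) * g k) + ∑ k, c k • monom T (e k) := by
        have : ∀ k, monom T (e k) * g k =
            c k • monom T (e k) + ∑ i, monom T (e k + Pi.single i 1) * g' k i := by
          intro k
          conv_lhs => rw [hg' k]
          rw [mul_add, Finset.mul_sum, Algebra.smul_def, mul_comm (monom T (e k))]
          simp [monom_add_single, mul_assoc]
        rw [Fintype.sum_prod_type]
        simp only [this, Finset.sum_add_distrib]
        ring
      rw [key]
      refine add_mem (lowSpan_mono T n.le_succ hf) (sum_mem fun k _ => ?_)
      exact Submodule.smul_mem _ _ (monom_mem_lowSpan T (by rw [he]; exact n.lt_succ_self))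
    · calc ‖g' p.1 p.2‖ ≤ C * ‖g p.1‖ := hn _ _
        _ ≤ C * (C ^ n * ‖f‖) := by gcongr; exact hg _
        _ = C ^ (n + 1) * ‖f‖ := by ring

variable [CompleteSpace A]

theorem GeneratesModScalars.exists_bound {T : ι → A} (hT : GeneratesModScalars T) :
    ∃ C : ℝ, 0 ≤ C ∧ ∀ f : A, ∃ (c : ℂ) (g : ι → A),
      f = algebraMap ℂ A c + ∑ i, T i * g i ∧ ∀ i, ‖g i‖ ≤ C * ‖f‖ := by
  let Φ : ℂ × (ι → A) →L[ℂ] A :=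
    (Algebra.linearMap ℂ A).toContinuousLinearMap.comp (ContinuousLinearMap.fst ℂ ℂ (ι → A)) +
    ∑ i, (ContinuousLinearMap.mul ℂ A (T i)).comp
      ((ContinuousLinearMap.proj (φ := fun _ : ι => A) i).comp
        (ContinuousLinearMap.snd ℂ ℂ (ι → A)))
  have hΦ : ∀ x, Φ x = algebraMap ℂ A x.1 + ∑ i, T i * x.2 i := fun x => by simp [Φ]
  obtain ⟨C, hC, h⟩ := Φ.exists_preimage_norm_le fun f => by
    obtain ⟨c, g, hf⟩ := hT f
    exact ⟨(c, g), by rw [hΦ, hf]⟩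
  refine ⟨C, hC.le, fun f => ?_⟩
  obtain ⟨x, hx, hn⟩ := h f
  exact ⟨x.1, x.2, by rw [← hΦ, hx],
    fun i => (norm_le_pi_norm x.2 i).trans ((norm_snd_le x).trans hn)⟩

theorem GeneratesModScalars.exists_sub_mem_pow {T : ι → A} (hT : GeneratesModScalars T)
    (n : ℕ) (f : A) : ∃ p ∈ lowSpan T n, f - p ∈ Ideal.span (range T) ^ n := by
  obtain ⟨C, hC, h⟩ := hT.exists_bound
  obtain ⟨κ, _, e, g, -, he, hf, -⟩ := exists_monom_expansion T hC h n f
  refine ⟨_, hf, ?_⟩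
  rw [sub_sub_cancel]
  refine sum_mem fun k _ => Ideal.mul_mem_right _ _ ?_
  have := monom_mem_pow T (e k)
  rwa [he] at this

theorem GeneratesModScalars.isClosed_of_pow_le {T : ι → A} (hT : GeneratesModScalars T)
    {n : ℕ} {P : Ideal A} (hP : Ideal.span (range T) ^ n ≤ P) : IsClosed (P : Set A) := by
  obtain ⟨s, hs⟩ : (Ideal.span (range T) ^ n).FG :=
    Ideal.FG.pow (Submodule.fg_span (finite_range T))
  let Φ : lowSpan T n × (s → A) →L[ℂ] A :=
    (lowSpan T n).subtypeL.comp (ContinuousLinearMap.fst ℂ _ (s → A)) +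
    ∑ i : s, (ContinuousLinearMap.mul ℂ A i).comp
      ((ContinuousLinearMap.proj (φ := fun _ : s => A) i).comp
        (ContinuousLinearMap.snd ℂ _ (s → A)))
  have hΦ : ∀ x, Φ x = x.1 + ∑ i : s, (i : A) * x.2 i := fun x => by simp [Φ]
  have hmem : ∀ g : s → A, ∑ i : s, (i : A) * g i ∈ Ideal.span (range T) ^ n := fun g =>
    sum_mem fun i _ => Ideal.mul_mem_right _ _ (hs ▸ Ideal.subset_span i.2)
  have surj : Function.Surjective Φ := fun f => by
    obtain ⟨p, hp, hf⟩ := hT.exists_sub_mem_pow n f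
    rw [← hs, Submodule.mem_span_finset'] at hf
    obtain ⟨g, hg⟩ := hf
    refine ⟨(⟨p, hp⟩, g), ?_⟩
    rw [hΦ]
    have : ∑ i : s, (i : A) * g i = f - p := by
      rw [← hg]
      exact Finset.sum_congr rfl fun i _ => mul_comm _ _
    rw [this, add_sub_cancel]
  have : CompleteSpace (lowSpan T n) := FiniteDimensional.complete ℂ _
  rw [← (Φ.isQuotientMap surj).isClosed_preimage]
  have heq : Φ ⁻¹' (P : Set A) =
      Prod.fst ⁻¹' (((P.restrictScalars ℂ).comap (lowSpan T n).subtype : Submodule ℂ _) :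
        Set (lowSpan T n)) := by
    ext x
    simp only [mem_preimage, hΦ, SetLike.mem_coe, Submodule.mem_comap,
      Submodule.restrictScalars_mem, Submodule.subtype_apply]
    exact P.add_mem_iff_left (hP (hmem _))
  rw [heq]
  exact (Submodule.closed_of_finiteDimensional _).preimage continuous_fst

omit [NormedAlgebra ℂ A] [CompleteSpace A] in
theorem exists_norm_monom_le {T : ι → A} {ε : ℝ} (hε : 0 ≤ ε)
    (h : ∀ i, ∃ K : ℝ, ∀ m : ℕ, ‖T i ^ m‖ ≤ K * ε ^ m) :
    ∃ K : ℝ, 0 ≤ K ∧ ∀ e : ι → ℕ, ‖monom T e‖ ≤ K * ε ^ (∑ i, e i) := by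
  classical
  suffices H : ∀ s : Finset ι, ∃ K : ℝ, 0 ≤ K ∧ ∀ e : ι → ℕ,
      ‖∏ i ∈ s, T i ^ e i‖ ≤ K * ε ^ (∑ i ∈ s, e i) from H Finset.univ
  intro s
  induction s using Finset.induction_on with
  | empty => exact ⟨‖(1 : A)‖, norm_nonneg _, fun e => by simp⟩
  | insert i s hi ih =>
    obtain ⟨K, hK, ih⟩ := ih
    obtain ⟨L, hL⟩ := h i
    have hL0 : 0 ≤ L := (norm_nonneg _).trans (by simpa using hL 0)
    refine ⟨L * K, by positivity, fun e => ?_⟩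
    rw [Finset.prod_insert hi, Finset.sum_insert hi]
    calc ‖T i ^ e i * ∏ j ∈ s, T j ^ e j‖ ≤ ‖T i ^ e i‖ * ‖∏ j ∈ s, T j ^ e j‖ := norm_mul_le _ _
      _ ≤ (L * ε ^ e i) * (K * ε ^ (∑ j ∈ s, e j)) := by
        gcongr
        · exact hL _
        · exact ih _
      _ = L * K * ε ^ (e i + ∑ j ∈ s, e j) := by rw [pow_add]; ring

theorem exists_norm_pow_le_of_spectralRadius_eq_zero {a : A} (ha : spectralRadius ℂ a = 0)
    {ε : ℝ} (hε : 0 < ε) : ∃ K : ℝ, ∀ m : ℕ, ‖a ^ m‖ ≤ K * ε ^ m := by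
  have h := spectrum.pow_nnnorm_pow_one_div_tendsto_nhds_spectralRadius a
  rw [ha] at h
  have h1 : ∀ᶠ m : ℕ in atTop, ‖a ^ m‖ * (ε ^ m)⁻¹ ≤ 1 := by
    filter_upwards [h.eventually (gt_mem_nhds (ENNReal.ofReal_pos.2 hε)), eventually_gt_atTop 0]
      with m hm hm0
    have hm' := ENNReal.rpow_le_rpow hm.le (Nat.cast_nonneg m : (0 : ℝ) ≤ m)
    rw [← ENNReal.rpow_mul, one_div_mul_cancel (by positivity), ENNReal.rpow_one,
      ENNReal.rpow_natCast, ← ENNReal.ofReal_pow hε.le, ← enorm_eq_nnnorm, ← ofReal_norm,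
      ENNReal.ofReal_le_ofReal_iff (by positivity)] at hm'
    rw [← div_eq_mul_inv]
    exact div_le_one_of_le₀ hm' (by positivity)
  obtain ⟨K, hK⟩ := (IsBoundedUnder.bddAbove_range (f := fun m : ℕ => ‖a ^ m‖ * (ε ^ m)⁻¹)
    ⟨1, by simpa using h1⟩)
  refine ⟨K, fun m => ?_⟩
  have := hK (mem_range_self m)
  rwa [← div_eq_mul_inv, div_le_iff₀ (by positivity)] at this

theorem GeneratesModScalars.exists_lowSpan_eq_top {T : ι → A} (hT : GeneratesModScalars T)
    (h : ∀ i, spectralRadius ℂ (T i) = 0) : ∃ n, lowSpan T n = ⊤ := by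
  obtain ⟨C, hC, hb⟩ := hT.exists_bound
  set D : ℝ := 2 * (Fintype.card ι * C + 1) with hD
  have hD0 : 0 < D := by positivity
  obtain ⟨K, hK0, hK⟩ := exists_norm_monom_le (T := T) (inv_nonneg.2 hD0.le)
    fun i => exists_norm_pow_le_of_spectralRadius_eq_zero (h i) (inv_pos.2 hD0)
  obtain ⟨n, hn⟩ : ∃ n : ℕ, K * (1 / 2 : ℝ) ^ n ≤ 1 / 2 := by
    have := (tendsto_pow_atTop_nhds_zero_of_lt_one (by norm_num : (0 : ℝ) ≤ 1 / 2)
      (by norm_num)).const_mul K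
    rw [mul_zero] at this
    exact (this.eventually (ge_mem_nhds (by norm_num))).exists
  have hCD : Fintype.card ι * C / D ≤ 1 / 2 := by
    rw [div_le_iff₀ hD0, hD]
    linarith
  refine ⟨n, ?_⟩
  by_contra hne
  obtain ⟨x, hx, hxF⟩ := riesz_lemma (lowSpan T n).closed_of_finiteDimensional
    (by simpa [Submodule.eq_top_iff'] using hne) (by norm_num : (3 / 4 : ℝ) < 1)
  obtain ⟨κ, _, e, g, hcard, he, hf, hg⟩ := exists_monom_expansion T hC hb n x
  have h1 := hxF _ hf
  rw [sub_sub_cancel] at h1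
  have h2 : ‖∑ k, monom T (e k) * g k‖ ≤ 1 / 2 * ‖x‖ := by
    calc ‖∑ k, monom T (e k) * g k‖ ≤ ∑ k : κ, K * D⁻¹ ^ n * (C ^ n * ‖x‖) := by
          refine norm_sum_le_of_le _ fun k _ => (norm_mul_le _ _).trans ?_
          gcongr
          · simpa [he] using hK (e k)
          · exact hg k
      _ = K * (Fintype.card ι * C / D) ^ n * ‖x‖ := by
          simp [hcard, div_eq_mul_inv, mul_pow]
          ring
      _ ≤ K * (1 / 2) ^ n * ‖x‖ := by
          gcongr
      _ ≤ 1 / 2 * ‖x‖ := by gcongr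
  have h3 : ‖x‖ ≤ 0 := by linarith
  rw [norm_le_zero_iff] at h3
  exact hx (h3 ▸ zero_mem _)

theorem GeneratesModScalars.exists_span_pow_eq_bot {T : ι → A} (hT : GeneratesModScalars T)
    (h : ∀ i, spectralRadius ℂ (T i) = 0) : ∃ n, Ideal.span (range T) ^ n = ⊥ := by
  obtain ⟨n, hn⟩ := hT.exists_lowSpan_eq_top h
  have : FiniteDimensional ℂ A := by
    have : FiniteDimensional ℂ (⊤ : Submodule ℂ A) := hn ▸ inferInstance
    exact Module.finite_def.2 (Module.Finite.iff_fg.1 this)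
  have : IsArtinianRing A := IsArtinianRing.of_finite ℂ A
  have hle : Ideal.span (range T) ≤ Ideal.jacobson ⊥ := by
    rw [Ideal.span_le]
    rintro _ ⟨i, rfl⟩
    rw [SetLike.mem_coe, Ideal.mem_jacobson_bot]
    intro y
    have hr : spectralRadius ℂ (T i * y) = 0 := by
      refine le_antisymm ?_ bot_le
      refine iSup₂_le fun k hk => ?_
      obtain ⟨χ, hχ⟩ := WeakDual.CharacterSpace.mem_spectrum_iff_exists.1 hk
      have : χ (T i) ∈ spectrum ℂ (T i) := WeakDual.CharacterSpace.mem_spectrum_iff_exists.2 ⟨χ, rfl⟩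
      have h0 : (‖χ (T i)‖₊ : ENNReal) ≤ 0 := (h i) ▸ le_iSup₂ (f := fun (k : ℂ)
        (_ : k ∈ spectrum ℂ (T i)) => (‖k‖₊ : ENNReal)) _ this
      rw [map_mul] at hχ
      have h1 : χ (T i) = 0 := by simpa using h0
      simp [← hχ, h1]
    have hres : (-1 : ℂ) ∈ resolventSet ℂ (T i * y) :=
      spectrum.mem_resolventSet_of_spectralRadius_lt (by simp [hr])
    rw [spectrum.mem_resolventSet_iff] at hres
    have := hres.neg
    convert this using 1
    simp
  obtain ⟨m, hm⟩ := IsArtinianRing.isNilpotent_jacobson_bot (R := A)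
  exact ⟨m, le_bot_iff.1 ((Ideal.pow_right_mono hle m).trans hm.le)⟩

end BanachAlgebra

section Contraction

variable {A : Type*} [NormedCommRing A] [NormedAlgebra ℂ A] [CompleteSpace A]
  {ι : Type} [Fintype ι]

theorem spectralRadius_eq_zero_of_forall_character {a : A} (h : ∀ χ : A →ₐ[ℂ] ℂ, χ a = 0) :
    spectralRadius ℂ a = 0 := by
  refine le_antisymm (iSup₂_le fun k hk => ?_) bot_le
  obtain ⟨χ, rfl⟩ := WeakDual.CharacterSpace.mem_spectrum_iff_exists.1 hk
  simpa using h (WeakDual.CharacterSpace.toAlgHom χ)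

theorem GeneratesModScalars.exists_pow_le_of_isClosed {T : ι → A} (hT : GeneratesModScalars T)
    {I : Ideal A} (hI : IsClosed (I : Set A))
    (hχ : ∀ χ : A →ₐ[ℂ] ℂ, (∀ h ∈ I, χ h = 0) → ∀ i, χ (T i) = 0) :
    ∃ n, Ideal.span (range T) ^ n ≤ I := by
  have := hI
  have hQ : GeneratesModScalars (fun i => Ideal.Quotient.mk I (T i)) := fun f => by
    obtain ⟨f, rfl⟩ := Ideal.Quotient.mk_surjective f
    obtain ⟨c, g, rfl⟩ := hT f
    exact ⟨c, fun i => Ideal.Quotient.mk I (g i), by simp⟩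
  obtain ⟨n, hn⟩ := hQ.exists_span_pow_eq_bot fun i =>
    spectralRadius_eq_zero_of_forall_character fun χ =>
      hχ (χ.comp (Ideal.Quotient.mkₐ ℂ I))
        (fun h hh => by simp [Ideal.Quotient.eq_zero_iff_mem.2 hh]) i
  refine ⟨n, ?_⟩
  rw [← Ideal.mk_ker (I := I), ← Ideal.map_eq_bot_iff_le_ker, Ideal.map_pow, Ideal.map_span,
    ← range_comp]
  exact hn

omit [CompleteSpace A] in
theorem lowSpan_le_range {T : ι → A} (S : A →ₐ[ℂ] A) {ρ : ℂ} (hρ : ρ ≠ 0)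
    (hS : ∀ i, S (T i) = ρ • T i) (n : ℕ) : lowSpan T n ≤ S.toLinearMap.range := by
  refine Submodule.span_le.2 ?_
  rintro _ ⟨e, -, rfl⟩
  refine ⟨(ρ ^ (∑ i, e i))⁻¹ • monom T e, ?_⟩
  have hmon : S (monom T e) = ρ ^ (∑ i, e i) • monom T e := by
    simp [monom, hS, smul_pow, Finset.prod_smul, Finset.prod_pow_eq_pow_sum]
  rw [AlgHom.toLinearMap_apply, map_smul, hmon, smul_smul,
    inv_mul_cancel₀ (pow_ne_zero _ hρ), one_smul]

theorem GeneratesModScalars.comap_pow_le {T : ι → A} (hT : GeneratesModScalars T)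
    (S : A →ₐ[ℂ] A) {ρ : ℂ} (hρ : ρ ≠ 0) (hS : ∀ i, S (T i) = ρ • T i) (n : ℕ) :
    (Ideal.span (range T) ^ n).comap S ≤ Ideal.span (range T) ^ n := by
  set N : Ideal A := Ideal.span (range T) ^ n with hN
  have hle : N ≤ N.comap S := by
    rw [← Ideal.map_le_iff_le_comap, hN, Ideal.map_pow]
    refine Ideal.pow_right_mono ?_ n
    rw [Ideal.map_span, Ideal.span_le]
    rintro _ ⟨_, ⟨i, rfl⟩, rfl⟩
    rw [hS, SetLike.mem_coe, Algebra.smul_def]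
    exact Ideal.mul_mem_left _ _ (Ideal.subset_span (mem_range_self i))
  let q : A →ₗ[ℂ] A ⧸ N := (Ideal.Quotient.mkₐ ℂ N).toLinearMap
  have hq : (lowSpan T n).map q = ⊤ := by
    rw [Submodule.eq_top_iff']
    intro x
    obtain ⟨f, rfl⟩ := Ideal.Quotient.mk_surjective x
    obtain ⟨p, hp, hf⟩ := hT.exists_sub_mem_pow n f
    exact ⟨p, hp, (Ideal.Quotient.eq.2 hf).symm⟩
  have : FiniteDimensional ℂ (A ⧸ N) :=
    Module.finite_def.2 (hq ▸ (Module.Finite.iff_fg.1 inferInstance : (lowSpan T n).FG).map q)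
  let S' : A ⧸ N →ₗ[ℂ] A ⧸ N := (Ideal.quotientMapₐ N S hle).toLinearMap
  have hS' : ∀ f, S' (q f) = q (S f) := fun f => rfl
  have hinj : Function.Injective S' := by
    rw [LinearMap.injective_iff_surjective]
    intro x
    obtain ⟨p, hp, rfl⟩ : x ∈ (lowSpan T n).map q := hq ▸ Submodule.mem_top
    obtain ⟨f, rfl⟩ := lowSpan_le_range S hρ hS n hp
    exact ⟨q f, rfl⟩
  intro f hf
  have h0 : S' (q f) = S' 0 := by
    rw [hS', map_zero]
    exact Ideal.Quotient.eq_zero_iff_mem.2 hf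
  exact Ideal.Quotient.eq_zero_iff_mem.1 (hinj h0)

/-- If `S` contracts the generators `T i` of a maximal ideal `M`, and `M` is the only maximal
ideal containing the image of `J` under `S`, then some `φ ∈ 1 + M` carries a power of every
`T i` into `J`. -/
theorem GeneratesModScalars.exists_mul_pow_mem {T : ι → A} (hT : GeneratesModScalars T)
    (S : A →ₐ[ℂ] A) {ρ : ℂ} (hρ : ρ ≠ 0) (hS : ∀ i, S (T i) = ρ • T i) (J : Ideal A)
    (hχ : ∀ χ : A →ₐ[ℂ] ℂ, (∀ h ∈ J, χ (S h) = 0) → ∀ i, χ (T i) = 0) :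
    ∃ (φ : A) (n : ℕ), φ - 1 ∈ Ideal.span (range T) ∧ ∀ i, φ * T i ^ n ∈ J := by
  set M : Ideal A := Ideal.span (range T) with hM
  obtain ⟨n, hn⟩ := hT.exists_pow_le_of_isClosed (I := (J.map S).closure) isClosed_closure
    fun χ h => hχ χ fun f hf => h _ (subset_closure (Ideal.mem_map_of_mem S hf))
  have h1 : M ^ n ≤ J.map S ⊔ M ^ (n + 1) := by
    have hc : IsClosed ((J.map S ⊔ M ^ (n + 1) : Ideal A) : Set A) :=
      hT.isClosed_of_pow_le le_sup_right
    exact fun f hf => closure_minimal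
      (SetLike.coe_subset_coe.2 (le_sup_left : J.map S ≤ J.map S ⊔ M ^ (n + 1))) hc (hn hf)
  have h2 : ∀ f ∈ J.map S, ∃ h ∈ J, f - S h ∈ M ^ (n + 1) := by
    intro f hf
    induction hf using Submodule.span_induction with
    | mem x hx =>
      obtain ⟨h, hh, rfl⟩ := hx
      exact ⟨h, hh, by simp⟩
    | zero => exact ⟨0, J.zero_mem, by simp⟩
    | add x y _ _ hx hy =>
      obtain ⟨h, hh, hx⟩ := hx
      obtain ⟨k, hk, hy⟩ := hy
      exact ⟨h + k, J.add_mem hh hk, by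
        rw [map_add, add_sub_add_comm]; exact add_mem hx hy⟩
    | smul a x _ hx =>
      obtain ⟨h, hh, hx⟩ := hx
      obtain ⟨p, hp, ha⟩ := hT.exists_sub_mem_pow (n + 1) a
      obtain ⟨r, rfl⟩ := lowSpan_le_range S hρ hS _ hp
      refine ⟨r * h, J.mul_mem_left _ hh, ?_⟩
      have : a • x - S (r * h) = a * (x - S h) + (a - S r) * S h := by
        rw [map_mul, smul_eq_mul]; ring
      rw [this]
      exact add_mem (Ideal.mul_mem_left _ _ hx) (Ideal.mul_mem_right _ _ ha)
  have h3 : M ^ n ≤ J ⊔ M • M ^ n := by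
    intro f hf
    have hSf : S f ∈ M ^ n := by
      have hle : M.map S ≤ M := by
        rw [hM, Ideal.map_span, Ideal.span_le]
        rintro _ ⟨_, ⟨i, rfl⟩, rfl⟩
        rw [hS, SetLike.mem_coe, Algebra.smul_def]
        exact Ideal.mul_mem_left _ _ (Ideal.subset_span (mem_range_self i))
      have := Ideal.mem_map_of_mem S hf
      rw [Ideal.map_pow] at this
      exact Ideal.pow_right_mono hle n this
    obtain ⟨x, hx, y, hy, hxy⟩ := Submodule.mem_sup.1 (h1 hSf)
    obtain ⟨h, hh, hxh⟩ := h2 x hx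
    have h4 : f - h ∈ M ^ (n + 1) := by
      refine hT.comap_pow_le S hρ hS (n + 1) ?_
      rw [Ideal.mem_comap, map_sub, ← hxy, add_sub_right_comm]
      exact add_mem hxh hy
    rw [smul_eq_mul, ← pow_succ']
    exact Submodule.mem_sup.2 ⟨h, hh, f - h, h4, by ring⟩
  obtain ⟨φ, hφ, hle⟩ := Submodule.exists_sub_one_mem_and_smul_le_of_fg_of_le_sup
    (Ideal.FG.pow (Submodule.fg_span (finite_range T))) le_rfl h3
  refine ⟨φ, n, hφ, fun i => hle ?_⟩
  exact Submodule.smul_mem_pointwise_smul _ φ _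
    (Ideal.pow_mem_pow (Ideal.subset_span (mem_range_self i)) n)

end Contraction

/-! ### Division of polynomials on the ball with bounds -/

section Division

/-- From an interior point `a` of the ball and any point `z` of the closed ball, every unit
vector splits into a multiple of `z - a` and a vector `τ` in whose direction the ball contains
discs of radius comparable to `√(1 - t)` around the points `a + t (z - a)`. -/
theorem exists_decomposition_of_norm_lt_one {E : Type*} [NormedAddCommGroup E]
    [InnerProductSpace ℂ E] {a : E} (ha : ‖a‖ < 1) :
    ∃ C κ : ℝ, 0 ≤ C ∧ 0 < κ ∧ ∀ z : E, ‖z‖ ≤ 1 → ∀ e : E, ‖e‖ ≤ 1 →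
      ∃ (c : ℂ) (τ : E), e = c • (z - a) + τ ∧ ‖c‖ ≤ C ∧
        ∀ t ∈ Icc (0 : ℝ) 1, ∀ s : ℂ, ‖s‖ ≤ κ * √(1 - t) →
          ‖a + ((t : ℂ) • (z - a) + s • τ)‖ ≤ 1 := by
  set δ : ℝ := 1 - ‖a‖ with hδ
  have hδ0 : 0 < δ := by linarith
  have hδ1 : δ ≤ 1 := by linarith [norm_nonneg a]
  refine ⟨4 / δ, δ ^ 2 / 36, by positivity, by positivity, fun z hz e he => ?_⟩
  have hx : ∀ t ∈ Icc (0 : ℝ) 1, ‖a + (t : ℂ) • (z - a)‖ ≤ (1 - t) * ‖a‖ + t * ‖z‖ := by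
    rintro t ⟨h0, h1⟩
    have : a + (t : ℂ) • (z - a) = ((1 - t : ℝ) : ℂ) • a + (t : ℂ) • z := by
      push_cast
      module
    rw [this]
    refine (norm_add_le _ _).trans (le_of_eq ?_)
    rw [norm_smul, norm_smul, Complex.norm_of_nonneg (by linarith), Complex.norm_of_nonneg h0]
  rcases le_or_gt ‖z‖ (1 - δ / 2) with hz' | hz'
  · refine ⟨0, e, by simp, by simpa using by positivity, fun t ht s hs => ?_⟩
    have h1 := hx t ht
    have h2 : √(1 - t) ≤ 1 := Real.sqrt_le_one.2 (by linarith [ht.1])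
    have h3 : ‖s • e‖ ≤ δ / 2 := by
      rw [norm_smul]
      calc ‖s‖ * ‖e‖ ≤ (δ ^ 2 / 36 * 1) * 1 := by gcongr; exact hs.trans (by gcongr)
        _ ≤ δ / 2 := by nlinarith
    rw [← add_assoc]
    refine (norm_add_le _ _).trans ?_
    nlinarith [ht.1, ht.2]
  · have hin : δ / 4 ≤ ‖inner ℂ z (z - a)‖ := by
      have h1 : ‖inner ℂ z z‖ - ‖inner ℂ z a‖ ≤ ‖inner ℂ z (z - a)‖ := by
        rw [inner_sub_right]
        exact norm_sub_norm_le _ _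
      have h2 : ‖inner ℂ z z‖ = ‖z‖ ^ 2 := by
        rw [inner_self_eq_norm_sq_to_K]
        simp
      have h3 := norm_inner_le_norm (𝕜 := ℂ) z a
      nlinarith
    have hin0 : inner ℂ z (z - a) ≠ 0 := norm_pos_iff.1 (by linarith)
    set c : ℂ := inner ℂ z e / inner ℂ z (z - a) with hc
    have hcn : ‖c‖ ≤ 4 / δ := by
      rw [hc, norm_div, div_le_div_iff₀ (by linarith) hδ0]
      have := norm_inner_le_norm (𝕜 := ℂ) z e
      have : ‖z‖ * ‖e‖ ≤ 1 := mul_le_one₀ hz (norm_nonneg _) he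
      nlinarith
    set τ : E := e - c • (z - a) with hτ
    have hτz : inner ℂ z τ = 0 := by
      rw [hτ, inner_sub_right, inner_smul_right, hc, div_mul_cancel₀ _ hin0, sub_self]
    have hτn : ‖τ‖ ≤ 9 / δ := by
      have h1 : ‖z - a‖ ≤ 2 := (norm_sub_le _ _).trans (by linarith)
      calc ‖τ‖ ≤ ‖e‖ + ‖c‖ * ‖z - a‖ := by
            rw [hτ, ← norm_smul]; exact norm_sub_le _ _
        _ ≤ 1 + 4 / δ * 2 := by gcongr
        _ ≤ 9 / δ := by
          rw [le_div_iff₀ hδ0]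
          field_simp
          linarith
    refine ⟨c, τ, by rw [hτ]; abel, hcn, fun t ht s hs => ?_⟩
    obtain ⟨h0, h1⟩ := ht
    have hu : 0 ≤ 1 - t := by linarith
    set x : E := a + (t : ℂ) • (z - a) with hxdef
    have hxn : ‖x‖ ≤ 1 - (1 - t) * δ := (hx t ⟨h0, h1⟩).trans (by nlinarith)
    have hinx : inner ℂ x τ = ((1 - t : ℝ) : ℂ) * inner ℂ a τ := by
      have : x = ((1 - t : ℝ) : ℂ) • a + (t : ℂ) • z := by
        rw [hxdef]
        push_cast
        module
      rw [this, inner_add_left, inner_smul_left, inner_smul_left, hτz, Complex.conj_ofReal]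
      simp
    have hsτ : ‖s‖ * ‖τ‖ ≤ δ / 4 * √(1 - t) := by
      calc ‖s‖ * ‖τ‖ ≤ (δ ^ 2 / 36 * √(1 - t)) * (9 / δ) := by gcongr
        _ = δ / 4 * √(1 - t) := by field_simp; ring
    have hsq : √(1 - t) ≤ 1 := Real.sqrt_le_one.2 (by linarith)
    have hre : RCLike.re (inner ℂ x (s • τ)) ≤ (1 - t) * (δ / 4) := by
      refine (RCLike.re_le_norm _).trans ?_
      rw [inner_smul_right, hinx, norm_mul, norm_mul, Complex.norm_of_nonneg hu]
      have h2 : ‖inner ℂ a τ‖ ≤ ‖τ‖ := (norm_inner_le_norm (𝕜 := ℂ) a τ).trans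
        (mul_le_of_le_one_left (norm_nonneg _) ha.le)
      calc ‖s‖ * ((1 - t) * ‖inner ℂ a τ‖) ≤ ‖s‖ * ((1 - t) * ‖τ‖) := by gcongr
        _ = (1 - t) * (‖s‖ * ‖τ‖) := by ring
        _ ≤ (1 - t) * (δ / 4 * 1) := mul_le_mul_of_nonneg_left
          (hsτ.trans (mul_le_mul_of_nonneg_left hsq (by positivity))) hu
        _ = _ := by ring
    have hsq2 : ‖s • τ‖ ^ 2 ≤ (1 - t) * (δ ^ 2 / 16) := by
      rw [norm_smul]
      calc (‖s‖ * ‖τ‖) ^ 2 ≤ (δ / 4 * √(1 - t)) ^ 2 := by gcongr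
        _ = _ := by rw [mul_pow, Real.sq_sqrt hu]; ring
    have hx2 : ‖x‖ ^ 2 ≤ 1 - (1 - t) * δ := by
      have : ‖x‖ ≤ 1 := by nlinarith
      nlinarith [norm_nonneg x]
    rw [← add_assoc, ← sq_le_one_iff₀ (norm_nonneg _), norm_add_sq (𝕜 := ℂ)]
    have : (1 - t) * (δ ^ 2 / 16) ≤ (1 - t) * (δ / 2) :=
      mul_le_mul_of_nonneg_left (by nlinarith) hu
    linarith

theorem MvPolynomial.hasDerivAt_eval_add_smul {ι : Type*} [Fintype ι] (P : MvPolynomial ι ℂ)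
    (x v : ι → ℂ) (s : ℂ) :
    HasDerivAt (fun s : ℂ => MvPolynomial.eval (x + s • v) P)
      (∑ i, v i * MvPolynomial.eval (x + s • v) (MvPolynomial.pderiv i P)) s := by
  classical
  induction P using MvPolynomial.induction_on with
  | C c => simpa using hasDerivAt_const s c
  | add p q hp hq =>
    simp only [map_add, mul_add, Finset.sum_add_distrib]
    exact hp.add hq
  | mul_X p j hp =>
    have hX : HasDerivAt (fun s : ℂ => x j + s * v j) (v j) s := by
      simpa using ((hasDerivAt_id s).mul_const (v j)).const_add (x j)
    have := hp.mul hX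
    simp only [map_mul, MvPolynomial.eval_X, Pi.add_apply, Pi.smul_apply, smul_eq_mul]
    refine this.congr_deriv ?_
    have hterm : ∀ i, v i * MvPolynomial.eval (x + s • v)
        (MvPolynomial.pderiv i (p * MvPolynomial.X j)) =
        v i * MvPolynomial.eval (x + s • v) (MvPolynomial.pderiv i p) * (x j + s * v j) +
          if i = j then MvPolynomial.eval (x + s • v) p * v i else 0 := fun i => by
      rw [Derivation.leibniz, MvPolynomial.pderiv_X]
      by_cases h : i = j
      · subst h
        simp
        ring
      · simp [h]
        ring
    simp only [hterm, Finset.sum_add_distrib, Finset.sum_mul]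
    simp

variable {d : ℕ}

/-- Evaluation of a polynomial in the coordinates centred at the origin. -/
def evalVec (P : MvPolynomial (Fin d) ℂ) (u : EuclideanSpace ℂ (Fin d)) : ℂ :=
  MvPolynomial.eval (fun i => u i) P

theorem continuous_evalVec (P : MvPolynomial (Fin d) ℂ) : Continuous (evalVec P) :=
  (MvPolynomial.continuous_eval P).comp (by fun_prop)

theorem hasDerivAt_evalVec (P : MvPolynomial (Fin d) ℂ) (x v : EuclideanSpace ℂ (Fin d))
    (s : ℂ) : HasDerivAt (fun s : ℂ => evalVec P (x + s • v))
      (∑ i, v i * evalVec (MvPolynomial.pderiv i P) (x + s • v)) s :=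
  MvPolynomial.hasDerivAt_eval_add_smul P (fun i => x i) (fun i => v i) s

theorem hasDerivAt_evalVec_ofReal (P : MvPolynomial (Fin d) ℂ) (u : EuclideanSpace ℂ (Fin d))
    (t : ℝ) : HasDerivAt (fun t : ℝ => evalVec P ((t : ℂ) • u))
      (∑ i, u i * evalVec (MvPolynomial.pderiv i P) ((t : ℂ) • u)) t := by
  simpa using (hasDerivAt_evalVec P 0 u t).comp_ofReal

theorem integral_sum_mul_evalVec_pderiv (P : MvPolynomial (Fin d) ℂ)
    (u : EuclideanSpace ℂ (Fin d)) :
    ∫ t in (0 : ℝ)..1, ∑ i, u i * evalVec (MvPolynomial.pderiv i P) ((t : ℂ) • u) =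
      evalVec P u - evalVec P 0 := by
  rw [intervalIntegral.integral_eq_sub_of_hasDerivAt
    (fun t _ => hasDerivAt_evalVec_ofReal P u t)]
  · simp
  · refine Continuous.intervalIntegrable ?_ _ _
    refine continuous_finsetSum _ fun i _ => continuous_const.mul ?_
    exact (continuous_evalVec _).comp (by fun_prop)

theorem exists_norm_integral_evalVec_pderiv_le {a : EuclideanSpace ℂ (Fin d)} (ha : ‖a‖ < 1) :
    ∃ D : ℝ, 0 ≤ D ∧ ∀ (P : MvPolynomial (Fin d) ℂ) (B : ℝ),
      (∀ z : EuclideanSpace ℂ (Fin d), ‖z‖ ≤ 1 → ‖evalVec P (z - a)‖ ≤ B) →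
      ∀ z : EuclideanSpace ℂ (Fin d), ‖z‖ ≤ 1 → ∀ i,
        ‖∫ t in (0 : ℝ)..1, evalVec (MvPolynomial.pderiv i P) ((t : ℂ) • (z - a))‖ ≤ D * B := by
  classical
  obtain ⟨C, κ, hC, hκ, hdec⟩ := exists_decomposition_of_norm_lt_one ha
  refine ⟨C * 2 + κ⁻¹ * 2, by positivity, fun P B hB z hz i => ?_⟩
  obtain ⟨c, τ, he, hcC, hdisc⟩ := hdec z hz (EuclideanSpace.single i 1) (by simp)
  set u := z - a with hu
  have hcont : ∀ v : EuclideanSpace ℂ (Fin d), Continuous fun t : ℝ =>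
      ∑ j, v j * evalVec (MvPolynomial.pderiv j P) ((t : ℂ) • u) := fun v =>
    continuous_finsetSum _ fun j _ => continuous_const.mul
      ((continuous_evalVec _).comp (by fun_prop))
  have hsplit : ∀ t : ℝ, evalVec (MvPolynomial.pderiv i P) ((t : ℂ) • u) =
      c * (∑ j, u j * evalVec (MvPolynomial.pderiv j P) ((t : ℂ) • u)) +
      ∑ j, τ j * evalVec (MvPolynomial.pderiv j P) ((t : ℂ) • u) := by
    intro t
    have hcoord : ∀ j, c * u j + τ j = if j = i then 1 else 0 := fun j => by
      have := congrArg (fun w : EuclideanSpace ℂ (Fin d) => w j) he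
      simpa [Pi.single_apply] using this.symm
    rw [Finset.mul_sum, ← Finset.sum_add_distrib]
    simp only [← mul_assoc, ← add_mul, hcoord]
    simp
  have hbound : ∀ t ∈ Ico (0 : ℝ) 1,
      ‖∑ j, τ j * evalVec (MvPolynomial.pderiv j P) ((t : ℂ) • u)‖ ≤
        κ⁻¹ * B * (1 - t) ^ (-(1 / 2) : ℝ) := by
    rintro t ⟨h0, h1⟩
    have hpos : 0 < κ * √(1 - t) := mul_pos hκ (Real.sqrt_pos.2 (by linarith))
    have hd := hasDerivAt_evalVec P ((t : ℂ) • u) τ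
    have h0' := (hd 0).deriv
    simp only [zero_smul, add_zero] at h0'
    rw [← h0']
    have hdiff : Differentiable ℂ fun s : ℂ => evalVec P ((t : ℂ) • u + s • τ) :=
      fun s => (hd s).differentiableAt
    refine (Complex.norm_deriv_le_of_forall_mem_sphere_norm_le hpos hdiff.diffContOnCl
      (C := B) fun s hs => ?_).trans (le_of_eq ?_)
    · have := hB _ (hdisc t ⟨h0, h1.le⟩ s (by simpa using (mem_sphere_zero_iff_norm.1 hs).le))
      simpa using this
    · rw [Real.rpow_neg (by linarith), ← Real.sqrt_eq_rpow]
      field_simp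
  have hg : ∫ t in (0 : ℝ)..1, (1 - t) ^ (-(1 / 2) : ℝ) = 2 := by
    rw [intervalIntegral.integral_comp_sub_left (fun t : ℝ => t ^ (-(1 / 2) : ℝ)),
      integral_rpow (Or.inl (by norm_num))]
    norm_num
  have hgi : IntervalIntegrable (fun t : ℝ => (1 - t) ^ (-(1 / 2) : ℝ)) volume 0 1 := by
    have := (intervalIntegral.intervalIntegrable_rpow' (a := 1) (b := 0)
      (by norm_num : (-1 : ℝ) < -(1 / 2))).comp_sub_left 1
    simpa using this
  have h2 : ‖∫ t in (0 : ℝ)..1, ∑ j, τ j * evalVec (MvPolynomial.pderiv j P) ((t : ℂ) • u)‖ ≤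
      κ⁻¹ * B * 2 := by
    rw [← hg, ← intervalIntegral.integral_const_mul]
    refine intervalIntegral.norm_integral_le_of_norm_le zero_le_one ?_ (hgi.const_mul _)
    filter_upwards [Measure.ae_ne volume (1 : ℝ)] with t ht1 ht
    exact hbound t ⟨ht.1.le, lt_of_le_of_ne ht.2 ht1⟩
  simp only [hsplit]
  rw [intervalIntegral.integral_add ((hcont u).const_mul c |>.intervalIntegrable _ _)
    ((hcont τ).intervalIntegrable _ _), intervalIntegral.integral_const_mul,
    integral_sum_mul_evalVec_pderiv]
  have hB0 : ‖evalVec P 0‖ ≤ B := by simpa using hB a ha.le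
  calc _ ≤ ‖c‖ * ‖evalVec P u - evalVec P 0‖ + κ⁻¹ * B * 2 := by
        refine (norm_add_le _ _).trans ?_
        rw [norm_mul]
        gcongr
    _ ≤ C * (B + B) + κ⁻¹ * B * 2 := by
        gcongr
        exact (norm_sub_le _ _).trans (add_le_add (hB z hz) hB0)
    _ = _ := by ring

end Division

/-! ### The ball algebra near an interior point -/

section BallAlgebra

variable {d : ℕ}

/-- The coordinate functions, as elements of the ball algebra. -/
def ballCoord (i : Fin d) : ballAlgSub d :=
  ⟨⟨fun z => (z : EuclideanSpace ℂ (Fin d)) i,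
      (EuclideanSpace.proj (𝕜 := ℂ) i).continuous.comp continuous_subtype_val⟩,
    (polyAlg d).le_topologicalClosure (Algebra.subset_adjoin ⟨i, rfl⟩)⟩

/-- The coordinate functions centred at `a`. -/
def centredCoord (a : EuclideanSpace ℂ (Fin d)) (i : Fin d) : ballAlgSub d :=
  ballCoord i - algebraMap ℂ _ (a i)

/-- Evaluation of the functions of the ball algebra at a point. -/
def ballEval (x : CB d) : ballAlgSub d →ₐ[ℂ] ℂ :=
  (ContinuousMap.evalAlgHom ℂ ℂ x).comp (ballAlgSub d).val

instance inst_s3 : CompleteSpace (ballAlgSub d) :=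
  (polyAlg d).isClosed_topologicalClosure.completeSpace_coe

theorem ballEval_apply (x : CB d) (f : ballAlgSub d) : ballEval x f = (f : C(CB d, ℂ)) x := rfl

theorem norm_ballEval_le (x : CB d) (f : ballAlgSub d) : ‖ballEval x f‖ ≤ ‖f‖ :=
  (f : C(CB d, ℂ)).norm_coe_le_norm x

theorem continuous_ballEval (x : CB d) : Continuous (ballEval x) :=
  (continuous_eval_const x).comp continuous_subtype_val

theorem ballEval_ballCoord (x : CB d) (i : Fin d) :
    ballEval x (ballCoord i) = (x : EuclideanSpace ℂ (Fin d)) i := rfl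

theorem ballEval_centredCoord (a : EuclideanSpace ℂ (Fin d)) (x : CB d) (i : Fin d) :
    ballEval x (centredCoord a i) = (x - a : EuclideanSpace ℂ (Fin d)) i := by
  rw [centredCoord, map_sub, ballEval_ballCoord, AlgHom.commutes]
  rfl

theorem ballEval_aeval (a : EuclideanSpace ℂ (Fin d)) (x : CB d) (P : MvPolynomial (Fin d) ℂ) :
    ballEval x (MvPolynomial.aeval (centredCoord a) P) = evalVec P (x - a) := by
  rw [MvPolynomial.comp_aeval_apply, MvPolynomial.aeval_eq_eval, evalVec]
  simp only [ballEval_centredCoord]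

theorem ballAlgSub_ext {f g : ballAlgSub d} (h : ∀ x, ballEval x f = ballEval x g) : f = g :=
  Subtype.ext (ContinuousMap.ext h)

theorem denseRange_aeval_centredCoord (a : EuclideanSpace ℂ (Fin d)) :
    DenseRange (MvPolynomial.aeval (R := ℂ) (centredCoord a)) := by
  have hle : polyAlg d ≤ (MvPolynomial.aeval (R := ℂ) (centredCoord a)).range.map
      (ballAlgSub d).val := by
    refine Algebra.adjoin_le ?_
    rintro _ ⟨i, rfl⟩
    refine ⟨ballCoord i, ⟨MvPolynomial.X i + MvPolynomial.C (a i), ?_⟩, rfl⟩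
    simp [centredCoord]
  refine Subtype.dense_iff.2 fun f hf => closure_mono ?_ hf
  rintro p hp
  obtain ⟨g, ⟨P, rfl⟩, hg⟩ := hle hp
  exact ⟨_, ⟨P, rfl⟩, hg⟩

theorem norm_coe_closedBall_le (x : CB d) : ‖(x : EuclideanSpace ℂ (Fin d))‖ ≤ 1 :=
  mem_closedBall_zero_iff.1 x.2

theorem norm_le_of_ballEval {f : ballAlgSub d} {C : ℝ} (hC : 0 ≤ C)
    (h : ∀ x, ‖ballEval x f‖ ≤ C) : ‖f‖ ≤ C :=
  ((f : C(CB d, ℂ)).norm_le hC).2 h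

theorem exists_division_of_polynomial {a : EuclideanSpace ℂ (Fin d)} (ha : ‖a‖ < 1) :
    ∃ D : ℝ, 0 ≤ D ∧ ∀ P : MvPolynomial (Fin d) ℂ, ∃ (c : ℂ) (g : Fin d → ballAlgSub d),
      MvPolynomial.aeval (centredCoord a) P =
        algebraMap ℂ _ c + ∑ i, centredCoord a i * g i ∧
      ‖c‖ ≤ ‖MvPolynomial.aeval (centredCoord a) P‖ ∧
      ∀ i, ‖g i‖ ≤ D * ‖MvPolynomial.aeval (centredCoord a) P‖ := by
  obtain ⟨D, hD, h⟩ := exists_norm_integral_evalVec_pderiv_le ha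
  refine ⟨D, hD, fun P => ?_⟩
  let F : Fin d → ℝ → ballAlgSub d := fun i t =>
    MvPolynomial.aeval (fun j => (t : ℂ) • centredCoord a j) (MvPolynomial.pderiv i P)
  have hF : ∀ i, Continuous (F i) := fun i => by
    simp only [F, MvPolynomial.aeval_def, MvPolynomial.eval₂_eq_eval_map]
    exact (MvPolynomial.continuous_eval _).comp (by fun_prop)
  have hFx : ∀ x i t, ballEval x (F i t) =
      evalVec (MvPolynomial.pderiv i P) ((t : ℂ) • (x - a : EuclideanSpace ℂ (Fin d))) := by
    intro x i t
    rw [MvPolynomial.comp_aeval_apply, MvPolynomial.aeval_eq_eval, evalVec]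
    simp only [map_smul, ballEval_centredCoord]
    rfl
  obtain ⟨g, hint⟩ : ∃ g : Fin d → ballAlgSub d, ∀ x i, ballEval x (g i) =
      ∫ t in (0 : ℝ)..1, evalVec (MvPolynomial.pderiv i P)
        ((t : ℂ) • (x - a : EuclideanSpace ℂ (Fin d))) := by
    refine ⟨fun i => ∫ t in (0 : ℝ)..1, F i t, fun x i => ?_⟩
    simp only [← hFx]
    exact (ContinuousLinearMap.intervalIntegral_comp_comm
      (⟨(ballEval x).toLinearMap, continuous_ballEval x⟩ : ballAlgSub d →L[ℂ] ℂ)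
      ((hF i).intervalIntegrable 0 1)).symm
  have hB : ∀ z : EuclideanSpace ℂ (Fin d), ‖z‖ ≤ 1 →
      ‖evalVec P (z - a)‖ ≤ ‖MvPolynomial.aeval (centredCoord a) P‖ := fun z hz => by
    have := norm_ballEval_le (⟨z, by simpa using hz⟩ : CB d)
      (MvPolynomial.aeval (centredCoord a) P)
    rwa [ballEval_aeval] at this
  refine ⟨evalVec P 0, g, ballAlgSub_ext fun x => ?_,
    (congrArg (‖evalVec P ·‖) (sub_self a)).symm.trans_le (hB a ha.le), fun i => ?_⟩
  · rw [map_add, map_sum, AlgHom.commutes, ballEval_aeval]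
    simp_rw [map_mul, hint, ballEval_centredCoord]
    have := integral_sum_mul_evalVec_pderiv P (x - a : EuclideanSpace ℂ (Fin d))
    rw [intervalIntegral.integral_finsetSum] at this
    · simp only [intervalIntegral.integral_const_mul] at this
      rw [this]
      simp
    · intro i _
      exact (continuous_const.mul ((continuous_evalVec _).comp
        (by fun_prop))).intervalIntegrable _ _
  · refine norm_le_of_ballEval (by positivity) fun x => ?_
    rw [hint]
    exact h P _ hB x (norm_coe_closedBall_le x) i

/-- Functions of the ball algebra vanishing at an interior point `a` are combinations of the
coordinates centred at `a`. -/
theorem generatesModScalars_centredCoord {a : EuclideanSpace ℂ (Fin d)} (ha : ‖a‖ < 1) :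
    GeneratesModScalars (centredCoord a) := by
  obtain ⟨D, hD, h⟩ := exists_division_of_polynomial ha
  let L : ℂ × (Fin d → ballAlgSub d) →L[ℂ] ballAlgSub d :=
    (ContinuousLinearMap.fst ℂ _ _).smulRight 1 + ∑ i,
      (ContinuousLinearMap.mul ℂ _ (centredCoord a i)).comp
        ((ContinuousLinearMap.proj i).comp (ContinuousLinearMap.snd ℂ _ _))
  have hL : ∀ c g, L (c, g) = algebraMap ℂ _ c + ∑ i, centredCoord a i * g i := fun c g => by
    simp [L, Algebra.algebraMap_eq_smul_one]
  let N := L.toLinearMap.toAddMonoidHom.mkNormedAddGroupHom ‖L‖ L.le_opNorm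
  let K := (MvPolynomial.aeval (R := ℂ) (centredCoord a)).toLinearMap.toAddMonoidHom.range
  have hN : N.SurjectiveOnWith K (D + 1) := by
    rintro _ ⟨P, rfl⟩
    obtain ⟨c, g, hP, hc, hg⟩ := h P
    refine ⟨(c, g), (hL c g).trans hP.symm, ?_⟩
    have hnn := norm_nonneg (MvPolynomial.aeval (R := ℂ) (centredCoord a) P)
    refine norm_prod_le_iff.2 ⟨hc.trans ?_, (pi_norm_le_iff_of_nonneg ?_).2 fun i =>
      (hg i).trans ?_⟩
    · exact le_mul_of_one_le_left hnn (by linarith)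
    · exact mul_nonneg (by linarith) hnn
    · exact mul_le_mul_of_nonneg_right (by linarith) hnn
  intro f
  obtain ⟨⟨c, g⟩, hcg, -⟩ := controlled_closure_of_complete (by linarith) one_pos hN f
    (denseRange_aeval_centredCoord a f)
  exact ⟨c, g, hcg.symm.trans (hL c g)⟩

/-- Characters of the ball algebra are point evaluations. -/
theorem exists_eq_ballEval (χ : ballAlgSub d →ₐ[ℂ] ℂ) : ∃ x : CB d, χ = ballEval x := by
  let x : EuclideanSpace ℂ (Fin d) := WithLp.toLp 2 fun i => χ (ballCoord i)
  let f : ballAlgSub d := ∑ i, star (x i) • ballCoord i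
  have hχf : χ f = ((‖x‖ ^ 2 : ℝ) : ℂ) := by
    have : ∀ i, χ (ballCoord i) = x i := fun i => rfl
    simp only [f, map_sum, map_smul, this, EuclideanSpace.norm_sq_eq, smul_eq_mul]
    push_cast
    exact Finset.sum_congr rfl fun i _ => Complex.conj_mul' (x i)
  have hf : ‖f‖ ≤ ‖x‖ := by
    refine norm_le_of_ballEval (norm_nonneg _) fun z => ?_
    have : ballEval z f = inner ℂ x (z : EuclideanSpace ℂ (Fin d)) := by
      simp [f, ballEval_ballCoord, PiLp.inner_apply, mul_comm]
    rw [this]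
    exact (norm_inner_le_norm _ _).trans (mul_le_of_le_one_right (norm_nonneg _)
      (norm_coe_closedBall_le z))
  have h1 : ‖(1 : ballAlgSub d)‖ ≤ 1 :=
    norm_le_of_ballEval zero_le_one fun z => by simp
  have hx : ‖x‖ ≤ 1 := by
    have h2 := AlgHom.norm_apply_le_self_mul_norm_one χ f
    rw [hχf, Complex.norm_of_nonneg (by positivity)] at h2
    have h3 : ‖x‖ ^ 2 ≤ ‖x‖ :=
      h2.trans ((mul_le_of_le_one_right (norm_nonneg _) h1).trans hf)
    nlinarith [norm_nonneg x]
  refine ⟨⟨x, by simpa using hx⟩, DFunLike.coe_injective ?_⟩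
  refine (denseRange_aeval_centredCoord 0).equalizer (map_continuous χ)
    (continuous_ballEval _) (funext fun P => ?_)
  simp only [Function.comp_apply, MvPolynomial.comp_aeval_apply]
  congr 2
  funext i
  simp [centredCoord, ballEval_ballCoord, x]

/-- The contraction of the ball towards its point `a` with ratio `ρ`. -/
def ballContraction (a : CB d) (ρ : unitInterval) : C(CB d, CB d) where
  toFun x := ⟨(a : EuclideanSpace ℂ (Fin d)) + (ρ : ℝ) • ((x : EuclideanSpace ℂ (Fin d)) - a),
    (convex_closedBall _ _).add_smul_sub_mem a.2 x.2 ρ.2⟩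
  continuous_toFun := by fun_prop

theorem comp_ballContraction_mem (a : CB d) (ρ : unitInterval) {f : C(CB d, ℂ)}
    (hf : f ∈ ballAlgSub d) : f.comp (ballContraction a ρ) ∈ ballAlgSub d := by
  have hle : polyAlg d ≤ (ballAlgSub d).comap
      (ContinuousMap.compRightAlgHom ℂ ℂ (ballContraction a ρ)) := by
    refine Algebra.adjoin_le ?_
    rintro _ ⟨i, rfl⟩
    change (⟨_, _⟩ : C(CB d, ℂ)).comp (ballContraction a ρ) ∈ ballAlgSub d
    convert (algebraMap ℂ (ballAlgSub d) ((a : EuclideanSpace ℂ (Fin d)) i) +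
      ((ρ : ℝ) : ℂ) • centredCoord (a : EuclideanSpace ℂ (Fin d)) i).2 using 1
    rfl
  refine closure_minimal (t := {f | f.comp (ballContraction a ρ) ∈ ballAlgSub d}) hle ?_ hf
  exact (polyAlg d).isClosed_topologicalClosure.preimage
    (ContinuousMap.continuous_precomp (ballContraction a ρ))

/-- Composition with a contraction of the ball, on the ball algebra. -/
def compContraction (a : CB d) (ρ : unitInterval) : ballAlgSub d →ₐ[ℂ] ballAlgSub d :=
  ((ContinuousMap.compRightAlgHom ℂ ℂ (ballContraction a ρ)).comp
    (ballAlgSub d).val).codRestrict _ fun f => comp_ballContraction_mem a ρ f.2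

theorem ballEval_compContraction (a : CB d) (ρ : unitInterval) (x : CB d) (f : ballAlgSub d) :
    ballEval x (compContraction a ρ f) = ballEval (ballContraction a ρ x) f := rfl

theorem compContraction_centredCoord (a : CB d) (ρ : unitInterval) (i : Fin d) :
    compContraction a ρ (centredCoord a i) = ((ρ : ℝ) : ℂ) • centredCoord a i := by
  refine ballAlgSub_ext fun x => ?_
  rw [ballEval_compContraction, map_smul, ballEval_centredCoord, ballEval_centredCoord]
  simp [ballContraction]

/-- The elements of the ball algebra vanishing on `X`, as an ideal. -/
def vanishingIdeal (X : Set (CB d)) : Ideal (ballAlgSub d) :=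
  ⨅ x ∈ X, RingHom.ker (ballEval x)

theorem mem_vanishingIdeal {X : Set (CB d)} {f : ballAlgSub d} :
    f ∈ vanishingIdeal X ↔ (f : C(CB d, ℂ)) ∈ IX d X := by
  simp only [vanishingIdeal, Ideal.mem_iInf, RingHom.mem_ker]
  exact (and_iff_right f.2).symm

theorem isOpen_openD (d : ℕ) : IsOpen (openD d) :=
  isOpen_lt (by fun_prop) continuous_const

end BallAlgebra

/-- at an isolated point of `Z(I(X)) ∩ 𝔹_d` there is a function of the
ball algebra equal to `1` there and vanishing on the rest of `Z(I(X))`. -/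
theorem stmt3 (d : ℕ) (hd : 1 ≤ d) (X : Set (CB d)) (z : CB d)
    (hz : IsIsolatedIn d (ZS d (IX d X) ∩ openD d) z) :
    ∃ φ ∈ ballAlg d, φ z = 1 ∧ ∀ w ∈ ZS d (IX d X) \ {z}, φ w = 0 := by
  obtain ⟨hzA, U, hU, hUz⟩ := hz
  have hzU : z ∈ U := (hUz.ge rfl).1
  have ha : ‖(z : EuclideanSpace ℂ (Fin d))‖ < 1 := hzA.2
  obtain ⟨ε, hε, hball⟩ := Metric.isOpen_iff.1 (hU.inter (isOpen_openD d)) z ⟨hzU, hzA.2⟩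
  obtain ⟨ρ, hρ0, hρ1⟩ := exists_between (lt_min one_pos (half_pos hε))
  let ρ' : unitInterval := ⟨ρ, hρ0.le, (hρ1.trans_le (min_le_left _ _)).le⟩
  have hρ : ((ρ' : ℝ) : ℂ) ≠ 0 := Complex.ofReal_ne_zero.2 hρ0.ne'
  have hmaps : ∀ x, ballContraction z ρ' x ∈ U ∩ openD d := fun x => hball <| by
    have hxz : ‖(x : EuclideanSpace ℂ (Fin d)) - z‖ ≤ 2 := (norm_sub_le _ _).trans
      (by linarith [norm_coe_closedBall_le x])
    rw [Metric.mem_ball, Subtype.dist_eq, dist_eq_norm]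
    calc _ = ρ * ‖(x : EuclideanSpace ℂ (Fin d)) - z‖ := by
          simp [ballContraction, ρ', norm_smul, abs_of_pos hρ0]
      _ ≤ ρ * 2 := by gcongr
      _ < ε := by linarith [hρ1.trans_le (min_le_right _ _)]
  obtain ⟨φ, n, hφ, hφJ⟩ := (generatesModScalars_centredCoord ha).exists_mul_pow_mem
    (compContraction z ρ') hρ (compContraction_centredCoord z ρ') (vanishingIdeal X) <| by
      intro χ hχ i
      obtain ⟨x, rfl⟩ := exists_eq_ballEval χ
      have hx : ballContraction z ρ' x ∈ ZS d (IX d X) := fun f hf =>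
        hχ ⟨f, hf.1⟩ (mem_vanishingIdeal.2 hf)
      have hxz : ballContraction z ρ' x = z := hUz.le ⟨(hmaps x).1, hx, (hmaps x).2⟩
      have h := congrArg (ballEval · (centredCoord z.1 i)) hxz
      simp only [← ballEval_compContraction, compContraction_centredCoord, map_smul] at h
      refine (smul_eq_zero.1 (h.trans ?_)).resolve_left hρ
      simp [ballEval_centredCoord]
  refine ⟨φ, φ.2, ?_, fun w hw => ?_⟩
  · have hker : Ideal.span (range (centredCoord z.1)) ≤ RingHom.ker (ballEval z) := by
      rw [Ideal.span_le]
      rintro _ ⟨i, rfl⟩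
      simp [RingHom.mem_ker, ballEval_centredCoord]
    have := RingHom.mem_ker.1 (hker hφ)
    rwa [map_sub, map_one, sub_eq_zero] at this
  · obtain ⟨i, hi⟩ : ∃ i, ballEval w (centredCoord z.1 i) ≠ 0 := by
      by_contra! h
      refine hw.2 (Subtype.ext (sub_eq_zero.1 (PiLp.ext fun i => ?_)))
      rw [← ballEval_centredCoord, h i]
      rfl
    have := hw.1 _ (mem_vanishingIdeal.1 (hφJ i))
    rw [← ballEval_apply, map_mul, map_pow] at this
    exact (mul_eq_zero.1 this).resolve_right (pow_ne_zero n hi)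

end
end
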